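/- arXiv:2107.06385 — 4 statements merged into one kernel-verified Lean document; each statement's English description precedes it below -/
import Mathlib

section
/- The group Aut(P_λ) is generated by the automorphism τ together with the automorphisms Δ_g for all g ∈ K[x]. -/
noncomputable section

open scoped Pointwise

variable (K : Type*) [Field K] [IsAlgClosed K] [CharZero K] (lam : K)

/-- `P_λ`: the quotient of `K[X,Y,Z]` by the ideal generated by `4XZ + Y² - λ`. -/
abbrev PQ : Type _ :=
  MvPolynomial (Fin 3) K ⧸
    Ideal.span {4 * MvPolynomial.X 0 * MvPolynomial.X 2 + MvPolynomial.X 1 ^ 2 -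
      MvPolynomial.C lam}

/-- `e`, the image of `X`. -/
def pe : PQ K lam := Ideal.Quotient.mk _ (MvPolynomial.X 0)

/-- `h`, the image of `Y`. -/
def ph : PQ K lam := Ideal.Quotient.mk _ (MvPolynomial.X 1)

/-- `f`, the image of `Z`. -/
def pf : PQ K lam := Ideal.Quotient.mk _ (MvPolynomial.X 2)

/-- A Poisson bracket on `P_λ`: a `K`-bilinear Lie bracket satisfying the Leibniz rule with
`{e,f} = h`, `{h,e} = 2e`, `{h,f} = -2f`. -/
structure PoissonBr : Type _ where
  br : PQ K lam → PQ K lam → PQ K lam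
  add_left : ∀ a b c, br (a + b) c = br a c + br b c
  add_right : ∀ a b c, br a (b + c) = br a b + br a c
  smul_left : ∀ (μ : K) (a b), br (μ • a) b = μ • br a b
  smul_right : ∀ (μ : K) (a b), br a (μ • b) = μ • br a b
  alternate : ∀ a, br a a = 0
  jacobi : ∀ a b c, br a (br b c) + br b (br c a) + br c (br a b) = 0
  leibniz : ∀ a b c, br a (b * c) = b * br a c + br a b * c
  br_ef : br (pe K lam) (pf K lam) = ph K lam
  br_he : br (ph K lam) (pe K lam) = 2 * pe K lam
  br_hf : br (ph K lam) (pf K lam) = -2 * pf K lam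

variable {K lam}

/-- `Aut(P_λ)`: the subgroup of `K`-algebra automorphisms of `P_λ` preserving the bracket.
Multiplication is composition: `(θ * φ) x = θ (φ x)`. -/
def PAut (B : PoissonBr K lam) : Subgroup ((PQ K lam) ≃ₐ[K] (PQ K lam)) where
  carrier := {φ | ∀ a b, φ (B.br a b) = B.br (φ a) (φ b)}
  one_mem' := fun _ _ => rfl
  mul_mem' := by
    intro φ ψ hφ hψ a b
    show φ (ψ (B.br a b)) = _
    rw [hψ, hφ]
    rfl
  inv_mem' := by
    intro φ hφ a b
    apply φ.injective
    show φ (φ.symm (B.br a b)) = φ (B.br (φ.symm a) (φ.symm b))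
    rw [hφ]
    simp

/-- `D` is the automorphism `Δ_g`:
`e ↦ e − g(f)h − f·g(f)²`, `h ↦ h + 2f·g(f)`, `f ↦ f`. -/
def IsDelta (B : PoissonBr K lam) (g : Polynomial K) (D : ↥(PAut B)) : Prop :=
  D.val (pe K lam) =
      pe K lam - Polynomial.aeval (pf K lam) g * ph K lam -
        pf K lam * Polynomial.aeval (pf K lam) g ^ 2 ∧
  D.val (ph K lam) = ph K lam + 2 * (pf K lam * Polynomial.aeval (pf K lam) g) ∧
  D.val (pf K lam) = pf K lam

/-- `D` is the automorphism `τ`: `e ↦ f`, `h ↦ -h`, `f ↦ e`. -/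
def IsTau (B : PoissonBr K lam) (D : ↥(PAut B)) : Prop :=
  D.val (pe K lam) = pf K lam ∧ D.val (ph K lam) = -ph K lam ∧ D.val (pf K lam) = pe K lam

/-- `D` is the automorphism `τ_α`: `e ↦ f`, `h ↦ -h + 2αf`, `f ↦ e + αh - α²f`. -/
def IsTauA (B : PoissonBr K lam) (α : K) (D : ↥(PAut B)) : Prop :=
  D.val (pe K lam) = pf K lam ∧
  D.val (ph K lam) = -ph K lam + (2 * α) • pf K lam ∧
  D.val (pf K lam) = pe K lam + α • ph K lam - α ^ 2 • pf K lam

/-- `D` is the hyperbolic rotation `H_β`: `e ↦ βe`, `h ↦ h`, `f ↦ β⁻¹f`. -/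
def IsHRot (B : PoissonBr K lam) (β : Kˣ) (D : ↥(PAut B)) : Prop :=
  D.val (pe K lam) = (β : K) • pe K lam ∧
  D.val (ph K lam) = ph K lam ∧
  D.val (pf K lam) = (β : K)⁻¹ • pf K lam

/-- The set `C` of linear triangular automorphisms:
`e ↦ βe + αh − (α²/β)f`, `h ↦ h − (2α/β)f`, `f ↦ β⁻¹f` with `α ∈ K`, `β ∈ Kˣ`. -/
def CsetLT (B : PoissonBr K lam) : Set ↥(PAut B) :=
  {D | ∃ (α : K) (β : Kˣ),
    D.val (pe K lam) = (β : K) • pe K lam + α • ph K lam - (α ^ 2 / (β : K)) • pf K lam ∧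
    D.val (ph K lam) = ph K lam - (2 * α / (β : K)) • pf K lam ∧
    D.val (pf K lam) = (β : K)⁻¹ • pf K lam}

/-! ### A Poisson bracket on Laurent polynomials over `k[X]` -/

section LaurentBracket

open Polynomial AddMonoidAlgebra

variable {k : Type*} [Field k]

/-- The derivation of `k[X][T;T⁻¹]` acting as `d/dX` on coefficients. -/
def coeffDeriv (x : LaurentPolynomial k[X]) : LaurentPolynomial k[X] :=
  .ofCoeff (Finsupp.onFinset x.coeff.support (fun n => derivative (x.coeff n)) (by
    intro n hn
    rw [Finsupp.mem_support_iff]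
    rintro h
    simp [h] at hn))

/-- The Euler derivation `T d/dT` of `k[X][T;T⁻¹]`. -/
def eulerDeriv (x : LaurentPolynomial k[X]) : LaurentPolynomial k[X] :=
  .ofCoeff (Finsupp.onFinset x.coeff.support (fun n => n • x.coeff n) (by
    intro n hn
    rw [Finsupp.mem_support_iff]
    rintro h
    simp [h] at hn))

@[simp] lemma coeff_coeffDeriv (x : LaurentPolynomial k[X]) (n : ℤ) :
    (coeffDeriv x).coeff n = derivative (x.coeff n) := rfl

@[simp] lemma coeff_eulerDeriv (x : LaurentPolynomial k[X]) (n : ℤ) :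
    (eulerDeriv x).coeff n = n • x.coeff n := rfl

@[simp] lemma coeffDeriv_zero : coeffDeriv (0 : LaurentPolynomial k[X]) = 0 :=
  LaurentPolynomial.ext fun n => by simp

@[simp] lemma eulerDeriv_zero : eulerDeriv (0 : LaurentPolynomial k[X]) = 0 :=
  LaurentPolynomial.ext fun n => by simp

lemma coeffDeriv_add (x y : LaurentPolynomial k[X]) :
    coeffDeriv (x + y) = coeffDeriv x + coeffDeriv y :=
  LaurentPolynomial.ext fun n => by simp

lemma eulerDeriv_add (x y : LaurentPolynomial k[X]) :
    eulerDeriv (x + y) = eulerDeriv x + eulerDeriv y :=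
  LaurentPolynomial.ext fun n => by simp

@[simp] lemma coeffDeriv_single (n : ℤ) (p : k[X]) :
    coeffDeriv (single n p : LaurentPolynomial k[X]) = single n (derivative p) :=
  LaurentPolynomial.ext fun m => by
    by_cases h : n = m <;> simp [-LaurentPolynomial.single_eq_C_mul_T, h]

@[simp] lemma eulerDeriv_single (n : ℤ) (p : k[X]) :
    eulerDeriv (single n p : LaurentPolynomial k[X]) = single n (n • p) :=
  LaurentPolynomial.ext fun m => by
    by_cases h : n = m <;> simp [-LaurentPolynomial.single_eq_C_mul_T, h]

lemma coeffDeriv_mul (x y : LaurentPolynomial k[X]) :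
    coeffDeriv (x * y) = coeffDeriv x * y + x * coeffDeriv y := by
  induction x using AddMonoidAlgebra.induction_linear with
  | zero => simp
  | add a b ha hb => simp only [add_mul, coeffDeriv_add, ha, hb]; ring
  | single m p =>
    induction y using AddMonoidAlgebra.induction_linear with
    | zero => simp
    | add a b ha hb => simp only [mul_add, coeffDeriv_add, ha, hb]; ring
    | single n q => simp [-LaurentPolynomial.single_eq_C_mul_T, single_mul_single, ← single_add]

lemma eulerDeriv_mul (x y : LaurentPolynomial k[X]) :
    eulerDeriv (x * y) = eulerDeriv x * y + x * eulerDeriv y := by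
  induction x using AddMonoidAlgebra.induction_linear with
  | zero => simp
  | add a b ha hb => simp only [add_mul, eulerDeriv_add, ha, hb]; ring
  | single m p =>
    induction y using AddMonoidAlgebra.induction_linear with
    | zero => simp
    | add a b ha hb => simp only [mul_add, eulerDeriv_add, ha, hb]; ring
    | single n q =>
      simp only [single_mul_single, eulerDeriv_single, ← single_add]
      congr 1
      simp only [zsmul_eq_mul, Int.cast_add]
      ring

/-- The Poisson bracket on `k[X][T;T⁻¹]` with `{T, X} = c T ^ (1 - R)`. -/
def laurentBr (c : k) (R : ℤ) (x y : LaurentPolynomial k[X]) : LaurentPolynomial k[X] :=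
  single (-R) (C c) * (eulerDeriv x * coeffDeriv y - coeffDeriv x * eulerDeriv y)

variable (c : k) (R : ℤ)

lemma laurentBr_add_right (x y z : LaurentPolynomial k[X]) :
    laurentBr c R x (y + z) = laurentBr c R x y + laurentBr c R x z := by
  simp only [laurentBr, eulerDeriv_add, coeffDeriv_add]; ring

lemma laurentBr_swap (x y : LaurentPolynomial k[X]) :
    laurentBr c R x y = -laurentBr c R y x := by
  simp only [laurentBr]; ring

lemma laurentBr_self (x : LaurentPolynomial k[X]) : laurentBr c R x x = 0 := by
  simp only [laurentBr]; ring

lemma laurentBr_mul (x y z : LaurentPolynomial k[X]) :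
    laurentBr c R x (y * z) = y * laurentBr c R x z + laurentBr c R x y * z := by
  simp only [laurentBr, eulerDeriv_mul, coeffDeriv_mul]; ring

lemma laurentBr_algebraMap (x : LaurentPolynomial k[X]) (a : k) :
    laurentBr c R x (algebraMap k _ a) = 0 := by
  simp [-LaurentPolynomial.single_eq_C_mul_T, laurentBr, coe_algebraMap]

/-- The Laurent polynomial `x` has no term of `T`-degree above `a`. -/
def DegLE (a : ℤ) (x : LaurentPolynomial k[X]) : Prop := ∀ n, a < n → x.coeff n = 0

variable {c R} {a b : ℤ} {x y : LaurentPolynomial k[X]}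

lemma DegLE.mul (hx : DegLE a x) (hy : DegLE b y) : DegLE (a + b) (x * y) := by
  intro n hn
  rw [AddMonoidAlgebra.coeff_mul]
  refine Finset.sum_eq_zero fun i hi => Finset.sum_eq_zero fun j hj => if_neg ?_
  rintro rfl
  rw [Finsupp.mem_support_iff] at hi hj
  have h1 : i ≤ a := le_of_not_gt fun h => hi (hx i h)
  have h2 : j ≤ b := le_of_not_gt fun h => hj (hy j h)
  omega

lemma DegLE.coeff_mul (hx : DegLE a x) (hy : DegLE b y) :
    (x * y).coeff (a + b) = x.coeff a * y.coeff b := by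
  rw [AddMonoidAlgebra.coeff_mul, Finsupp.sum, Finset.sum_eq_single a]
  · rw [Finsupp.sum, Finset.sum_eq_single b]
    · simp
    · intro j _ hj
      rw [if_neg]
      omega
    · intro hb
      rw [Finsupp.notMem_support_iff] at hb
      simp [hb]
  · intro i hi hia
    refine Finset.sum_eq_zero fun j hj => if_neg ?_
    intro hij
    rw [Finsupp.mem_support_iff] at hi hj
    have h1 : i ≤ a := le_of_not_gt fun h => hi (hx i h)
    have h2 : j ≤ b := le_of_not_gt fun h => hj (hy j h)
    omega
  · intro ha
    rw [Finsupp.notMem_support_iff] at ha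
    simp [ha]

lemma DegLE.eulerDeriv (hx : DegLE a x) : DegLE a (eulerDeriv x) := fun n hn => by
  simp [hx n hn]

lemma DegLE.coeffDeriv (hx : DegLE a x) : DegLE a (coeffDeriv x) := fun n hn => by
  simp [hx n hn]

lemma DegLE.sub (hx : DegLE a x) (hy : DegLE a y) : DegLE a (x - y) := fun n hn => by
  simp [hx n hn, hy n hn]

lemma DegLE.add (hx : DegLE a x) (hy : DegLE a y) : DegLE a (x + y) := fun n hn => by
  simp [hx n hn, hy n hn]

lemma DegLE.mono (hx : DegLE a x) (h : a ≤ b) : DegLE b x := fun n hn => hx n (by omega)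

lemma degLE_single (n : ℤ) (p : k[X]) : DegLE n (single n p) := fun m hm => by
  rw [coeff_single, Finsupp.single_eq_of_ne hm.ne']

lemma DegLE.laurentBr (hx : DegLE a x) (hy : DegLE b y) :
    DegLE (-R + (a + b)) (laurentBr c R x y) :=
  (degLE_single _ _).mul
    ((hx.eulerDeriv.mul hy.coeffDeriv).sub (hx.coeffDeriv.mul hy.eulerDeriv))

lemma DegLE.coeff_laurentBr (hx : DegLE a x) (hy : DegLE b y) :
    (_root_.laurentBr c R x y).coeff (-R + (a + b)) =
      C c * (C (a : k) * x.coeff a * derivative (y.coeff b) -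
        C (b : k) * derivative (x.coeff a) * y.coeff b) := by
  rw [_root_.laurentBr, (degLE_single _ _).coeff_mul
    ((hx.eulerDeriv.mul hy.coeffDeriv).sub (hx.coeffDeriv.mul hy.eulerDeriv)),
    AddMonoidAlgebra.coeff_sub, Finsupp.sub_apply, hx.eulerDeriv.coeff_mul hy.coeffDeriv,
    hx.coeffDeriv.coeff_mul hy.eulerDeriv]
  simp only [coeff_single, Finsupp.single_eq_same, coeff_eulerDeriv, coeff_coeffDeriv,
    zsmul_eq_mul, map_intCast]
  ring

lemma derivative_mul_pow_root (t : k) (m : ℕ) (s : k[X]) :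
    (X - C t) * derivative ((X - C t) ^ m * s) =
      (X - C t) ^ m * (C (m : k) * s + (X - C t) * derivative s) := by
  rw [derivative_mul, derivative_X_sub_C_pow]
  rcases m with _ | m
  · simp
  · simp only [map_natCast, Nat.add_sub_cancel]
    ring

/-- A root of the leading coefficient of `x` obstructs local nilpotency of `{x, ·}`. -/
theorem iterate_laurentBr_ne_zero [CharZero k] (hc : c ≠ 0) (hx : DegLE a x) {t : k} {m : ℕ}
    {s : k[X]} (hs : s.eval t ≠ 0) (hxa : x.coeff a = (X - C t) ^ m * s) (i : ℕ) :
    ∀ {y : LaurentPolynomial k[X]} {b : ℤ} {n : ℕ} {r : k[X]}, DegLE b y → r.eval t ≠ 0 →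
      y.coeff b = (X - C t) ^ n * r →
      (∀ j : ℕ, a * n - b * m + j * (m * R - a) ≠ 0) → (laurentBr c R x)^[i] y ≠ 0 := by
  induction i with
  | zero =>
    rintro y b n r - hr hyb - rfl
    have h : (X - C t) ^ n * r = 0 := by simpa using hyb.symm
    rcases mul_eq_zero.1 h with h | h
    · exact pow_ne_zero n (X_sub_C_ne_zero t) h
    · simp [h] at hr
  | succ i ih =>
    intro y b n r hy hr hyb hδ
    have h0 : a * n - b * m ≠ 0 := by simpa using hδ 0
    obtain ⟨l, hl⟩ : ∃ l, n + m = l + 1 := by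
      refine ⟨n + m - 1, ?_⟩
      have : n + m ≠ 0 := by
        intro h
        obtain ⟨rfl, rfl⟩ : n = 0 ∧ m = 0 := by omega
        simp at h0
      omega
    set q : k[X] := C c * (C ((a * n - b * m : ℤ) : k) * s * r +
      (X - C t) * (C (a : k) * s * derivative r - C (b : k) * derivative s * r)) with hq
    have hqt : q.eval t ≠ 0 := by
      have : ((a * n - b * m : ℤ) : k) ≠ 0 := by exact_mod_cast h0
      simp only [hq, eval_mul, eval_add, eval_C, eval_sub, eval_X, sub_self, zero_mul, add_zero]
      exact mul_ne_zero hc (mul_ne_zero (mul_ne_zero this hs) hr)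
    have hcoeff : (laurentBr c R x y).coeff (-R + (a + b)) = (X - C t) ^ l * q := by
      apply mul_left_cancel₀ (X_sub_C_ne_zero t)
      rw [hx.coeff_laurentBr hy, hxa, hyb]
      have h1 := derivative_mul_pow_root t m s
      have h2 := derivative_mul_pow_root t n r
      have h3 : (X - C t) * ((X - C t) ^ l * q) = (X - C t) ^ n * (X - C t) ^ m * q := by
        rw [← pow_add, hl]; ring
      rw [h3, hq]
      simp only [Int.cast_sub, Int.cast_mul, Int.cast_natCast, C_sub, C_mul]
      linear_combination C c * C (a : k) * (X - C t) ^ m * s * h2 -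
        C c * C (b : k) * ((X - C t) ^ n * r) * h1
    rw [Function.iterate_succ_apply]
    refine ih (hx.laurentBr hy) hqt hcoeff fun j => ?_
    have h1 := hδ (j + 1)
    have h2 : (n : ℤ) + m = l + 1 := by exact_mod_cast hl
    have h3 : (l : ℤ) = n + m - 1 := by omega
    rw [h3]
    push_cast at h1
    intro h
    apply h1
    rw [← h]
    ring

end LaurentBracket

/-! ### The quotient ring and its embeddings into Laurent polynomials -/

section Embedding

open Polynomial AddMonoidAlgebra

variable {k : Type*} [Field k] {lam : k}

lemma pe_mul_pf_add_sq : 4 * pe k lam * pf k lam + ph k lam ^ 2 = algebraMap k _ lam := by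
  rw [← sub_eq_zero]
  exact Ideal.Quotient.eq_zero_iff_mem.2 (Ideal.subset_span rfl)

lemma subalgebra_PQ_eq_top {S : Subalgebra k (PQ k lam)} (he : pe k lam ∈ S)
    (hh : ph k lam ∈ S) (hf : pf k lam ∈ S) (a : PQ k lam) : a ∈ S := by
  obtain ⟨p, rfl⟩ := Ideal.Quotient.mk_surjective a
  induction p using MvPolynomial.induction_on with
  | C c => exact S.algebraMap_mem c
  | add p q hp hq => rw [map_add]; exact S.add_mem hp hq
  | mul_X p i hp =>
    rw [map_mul]
    refine S.mul_mem hp ?_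
    fin_cases i
    exacts [he, hh, hf]

lemma algHom_PQ_ext {A : Type*} [Semiring A] [Algebra k A] {φ ψ : PQ k lam →ₐ[k] A}
    (he : φ (pe k lam) = ψ (pe k lam)) (hh : φ (ph k lam) = ψ (ph k lam))
    (hf : φ (pf k lam) = ψ (pf k lam)) : φ = ψ :=
  AlgHom.ext fun a =>
    subalgebra_PQ_eq_top (S := AlgHom.equalizer φ ψ) he hh hf a

/-- The homomorphism out of `P_λ` given by three elements satisfying its defining relation. -/
def liftPQ {A : Type*} [CommRing A] [Algebra k A] (x y z : A)
    (h : 4 * x * z + y ^ 2 = algebraMap k A lam) : PQ k lam →ₐ[k] A :=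
  Ideal.Quotient.liftₐ _ (MvPolynomial.aeval ![x, y, z]) (by
    intro a ha
    obtain ⟨b, rfl⟩ := Ideal.mem_span_singleton'.1 ha
    rw [map_mul]
    refine mul_eq_zero_of_right _ ?_
    simp [h])

section LiftPQ

variable {A : Type*} [CommRing A] [Algebra k A] (x y z : A)
  (h : 4 * x * z + y ^ 2 = algebraMap k A lam)

@[simp] lemma liftPQ_pe : liftPQ x y z h (pe k lam) = x := by
  exact (Ideal.Quotient.lift_mk ..).trans (by simp)

@[simp] lemma liftPQ_ph : liftPQ x y z h (ph k lam) = y := by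
  exact (Ideal.Quotient.lift_mk ..).trans (by simp)

@[simp] lemma liftPQ_pf : liftPQ x y z h (pf k lam) = z := by
  exact (Ideal.Quotient.lift_mk ..).trans (by simp)

end LiftPQ

variable (N R : ℤ)

/-- The substitution `T ↦ T ^ N`, `X ↦ X T ^ R` of `k[X][T;T⁻¹]`. -/
def laurentSubst : LaurentPolynomial k[X] →ₐ[k] LaurentPolynomial k[X] :=
  AddMonoidAlgebra.liftNCAlgHom (aeval (single R X))
    { toFun := fun n => single (n.toAdd * N) 1
      map_one' := by simp [-LaurentPolynomial.single_eq_C_mul_T, one_def]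
      map_mul' := fun m n => by
        simp [-LaurentPolynomial.single_eq_C_mul_T, single_mul_single, add_mul] }
    (fun _ _ => Commute.all _ _)

lemma laurentSubst_single_monomial (n : ℤ) (i : ℕ) (c : k) :
    laurentSubst N R (single n (monomial i c)) = single (n * N + i * R) (monomial i c) := by
  simp [-LaurentPolynomial.single_eq_C_mul_T, laurentSubst, aeval_monomial,
    single_pow, single_mul_single, coe_algebraMap, C_mul_X_pow_eq_monomial, add_comm]

variable [CharZero k]

/-- The embedding `f ↦ T ^ N`, `h ↦ X T ^ R` of `P_λ` into `k[X][T;T⁻¹]`. -/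
def toLaurentPQ : PQ k lam →ₐ[k] LaurentPolynomial k[X] :=
  liftPQ (single (-N) (C (lam / 4)) - single (2 * R - N) (C (1 / 4) * X ^ 2)) (single R X)
    (single N 1) (by
      have h4 : (4 : LaurentPolynomial k[X]) = single 0 (C 4) := rfl
      rw [h4, mul_sub, sub_mul]
      simp only [single_mul_single, single_pow, coe_algebraMap, mul_one, ← C_mul, ← mul_assoc,
        zero_add, neg_add_cancel, sub_add_cancel, nsmul_eq_mul, Nat.cast_ofNat,
        Function.comp_apply, algebraMap_eq]
      have h1 : (4 : k) * (lam / 4) = lam := by field_simp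
      have h2 : (4 : k) * (1 / 4) = 1 := by field_simp
      rw [h1, h2, C_1, one_mul, sub_add_cancel])

@[simp] lemma toLaurentPQ_pe : toLaurentPQ N R (pe k lam) =
    single (-N) (C (lam / 4)) - single (2 * R - N) (C (1 / 4) * X ^ 2) := liftPQ_pe ..

@[simp] lemma toLaurentPQ_ph : toLaurentPQ N R (ph k lam) = single R X := liftPQ_ph ..

@[simp] lemma toLaurentPQ_pf : toLaurentPQ N R (pf k lam) = single N 1 := liftPQ_pf ..

lemma laurentSubst_toLaurentPQ (a : PQ k lam) :
    laurentSubst N R (toLaurentPQ 1 0 a) = toLaurentPQ N R a := by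
  have h : ((laurentSubst N R).comp (toLaurentPQ 1 0) : PQ k lam →ₐ[k] _) = toLaurentPQ N R := by
    refine algHom_PQ_ext ?_ ?_ ?_
    · have h0 := laurentSubst_single_monomial N R (-1) 0 (lam / 4)
      have h2 := laurentSubst_single_monomial N R (-1) 2 (1 / 4 : k)
      rw [monomial_zero_left] at h0
      rw [← C_mul_X_pow_eq_monomial] at h2
      simp only [AlgHom.comp_apply, toLaurentPQ_pe, map_sub, mul_zero, zero_sub, h0, h2]
      congr 2 <;> push_cast <;> ring
    · have h1 := laurentSubst_single_monomial N R 0 1 (1 : k)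
      rw [monomial_one_one_eq_X] at h1
      simp [-LaurentPolynomial.single_eq_C_mul_T, h1]
    · have h1 := laurentSubst_single_monomial N R 1 0 (1 : k)
      rw [monomial_zero_left, C_1] at h1
      simp [-LaurentPolynomial.single_eq_C_mul_T, h1]
  exact DFunLike.congr_fun h a

end Embedding

/-! ### Normal forms in `P_λ` -/

section NormalForm

open Polynomial AddMonoidAlgebra

variable {k : Type*} [Field k] {lam : k}

lemma coeff_laurentSubst {N : ℤ} (hN : N ≠ 0) (R : ℤ) (x : LaurentPolynomial k[X]) (n : ℤ)
    (j : ℕ) : ((laurentSubst N R x).coeff (n * N + j * R)).coeff j = (x.coeff n).coeff j := by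
  induction x using AddMonoidAlgebra.induction_linear with
  | zero => simp
  | add x y hx hy => simp [hx, hy]
  | single m p =>
    induction p using Polynomial.induction_on' with
    | add p q hp hq => simp only [single_add, map_add, AddMonoidAlgebra.coeff_add,
        Finsupp.add_apply, Polynomial.coeff_add, hp, hq]
    | monomial i c =>
      rw [laurentSubst_single_monomial]
      by_cases hij : i = j
      · subst hij
        simp [-LaurentPolynomial.single_eq_C_mul_T, coeff_single, Finsupp.single_apply, hN]
      · have h (q : Prop) [Decidable q] :
            (if q then monomial i c else 0 : k[X]).coeff j = 0 := by
          split_ifs <;> simp [coeff_monomial, hij]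
        simp [-LaurentPolynomial.single_eq_C_mul_T, coeff_single, Finsupp.single_apply, h]

lemma coeff_laurentSubst_eq_zero {N R m : ℤ} {j : ℕ} (h : ∀ n : ℤ, m ≠ n * N + j * R)
    (x : LaurentPolynomial k[X]) : ((laurentSubst N R x).coeff m).coeff j = 0 := by
  induction x using AddMonoidAlgebra.induction_linear with
  | zero => simp
  | add x y hx hy => simp [hx, hy]
  | single n p =>
    induction p using Polynomial.induction_on' with
    | add p q hp hq => simp only [single_add, map_add, AddMonoidAlgebra.coeff_add,
        Finsupp.add_apply, Polynomial.coeff_add, hp, hq, add_zero]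
    | monomial i c =>
      rw [laurentSubst_single_monomial, coeff_single, Finsupp.single_apply]
      split_ifs with h1
      · rw [coeff_monomial, if_neg]
        rintro rfl
        exact h n h1.symm
      · simp

/-- The element `f ^ n` for `n ≥ 0` and `e ^ (-n)` for `n ≤ 0`. -/
def weightElt (n : ℤ) : PQ k lam := pf k lam ^ n.toNat * pe k lam ^ (-n).toNat

/-- The sum of the elements `q n (h) * weightElt n`. -/
def ofNormalForm : (ℤ →₀ k[X]) →ₗ[k] PQ k lam :=
  Finsupp.lsum k fun n =>
    (LinearMap.mulRight k (weightElt n)).comp (aeval (ph k lam)).toLinearMap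

lemma ofNormalForm_single (n : ℤ) (p : k[X]) :
    ofNormalForm (Finsupp.single n p) = aeval (ph k lam) p * weightElt n := by
  simp [ofNormalForm]

lemma ofNormalForm_induction {P : PQ k lam → Prop} (zero : P 0)
    (add : ∀ a b, P a → P b → P (a + b)) {q : ℤ →₀ k[X]}
    (h : ∀ n, P (aeval (ph k lam) (q n) * weightElt n)) : P (ofNormalForm q) := by
  rw [ofNormalForm, Finsupp.lsum_apply]
  exact Finset.sum_induction _ P add zero fun n _ => h n

variable [CharZero k]

/-- The polynomial through which `e f` is expressed by `h`. -/
def efPoly (lam : k) : k[X] := C (-(1 / 4)) * (X ^ 2 - C lam)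

lemma pe_mul_pf : pe k lam * pf k lam = aeval (ph k lam) (efPoly lam) := by
  have h := pe_mul_pf_add_sq (lam := lam)
  have h4 : algebraMap k (PQ k lam) (1 / 4) * 4 = 1 := by
    rw [← map_ofNat (algebraMap k (PQ k lam)) 4, ← map_mul]
    norm_num
  simp only [efPoly, map_mul, map_sub, map_pow, aeval_X, aeval_C, ← h, map_neg]
  linear_combination (-(pe k lam * pf k lam)) * h4

lemma natDegree_efPoly_pow (m : ℕ) : (efPoly lam ^ m).natDegree = 2 * m := by
  rw [natDegree_pow, efPoly, natDegree_C_mul (by simp), natDegree_X_pow_sub_C, mul_comm]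

lemma efPoly_ne_zero : efPoly lam ≠ 0 :=
  mul_ne_zero (by simp) (X_pow_sub_C_ne_zero two_pos lam)

lemma exists_weightElt_mul_pf (n : ℤ) :
    ∃ r : k[X], weightElt n * pf k lam = aeval (ph k lam) r * weightElt (n + 1) := by
  rcases le_or_gt 0 n with h | h
  · refine ⟨1, ?_⟩
    rw [weightElt, weightElt, show (n + 1).toNat = n.toNat + 1 by omega,
      show (-n).toNat = 0 by omega, show (-(n + 1)).toNat = 0 by omega]
    simp [pow_succ]
  · refine ⟨efPoly lam, ?_⟩
    rw [weightElt, weightElt, ← pe_mul_pf, show (-n).toNat = (-(n + 1)).toNat + 1 by omega,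
      show n.toNat = 0 by omega, show (n + 1).toNat = 0 by omega]
    ring

lemma exists_weightElt_mul_pe (n : ℤ) :
    ∃ r : k[X], weightElt n * pe k lam = aeval (ph k lam) r * weightElt (n - 1) := by
  rcases le_or_gt n 0 with h | h
  · refine ⟨1, ?_⟩
    rw [weightElt, weightElt, show (-(n - 1)).toNat = (-n).toNat + 1 by omega,
      show n.toNat = 0 by omega, show (n - 1).toNat = 0 by omega]
    simp [pow_succ]
  · refine ⟨efPoly lam, ?_⟩
    rw [weightElt, weightElt, ← pe_mul_pf, show n.toNat = (n - 1).toNat + 1 by omega,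
      show (-n).toNat = 0 by omega, show (-(n - 1)).toNat = 0 by omega]
    ring

lemma ofNormalForm_surjective (a : PQ k lam) : ∃ q, ofNormalForm q = a := by
  suffices h : ∀ (i : Fin 3) (q : ℤ →₀ k[X]),
      ofNormalForm q * Ideal.Quotient.mk _ (MvPolynomial.X i) ∈
        LinearMap.range (ofNormalForm (lam := lam)) by
    obtain ⟨p, rfl⟩ := Ideal.Quotient.mk_surjective a
    induction p using MvPolynomial.induction_on with
    | C c =>
      refine ⟨Finsupp.single 0 (C c), ?_⟩
      rw [ofNormalForm_single, aeval_C]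
      simp only [weightElt, Int.toNat_zero, neg_zero, pow_zero, mul_one]
      rfl
    | add p q hp hq =>
      obtain ⟨p', hp⟩ := hp
      obtain ⟨q', hq⟩ := hq
      exact ⟨p' + q', by rw [map_add, hp, hq, map_add]⟩
    | mul_X p i hp =>
      obtain ⟨p', hp⟩ := hp
      rw [map_mul, ← hp]
      exact h i p'
  intro i q
  induction q using Finsupp.induction_linear with
  | zero => simp
  | add p q hp hq => rw [map_add, add_mul]; exact add_mem hp hq
  | single n p =>
    rw [ofNormalForm_single, mul_assoc (aeval _ p)]
    fin_cases i
    · obtain ⟨r, hr⟩ := exists_weightElt_mul_pe (lam := lam) n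
      exact ⟨Finsupp.single (n - 1) (p * r), by
        rw [ofNormalForm_single, map_mul, mul_assoc, ← hr]; rfl⟩
    · exact ⟨Finsupp.single n (p * X), by
        rw [ofNormalForm_single, map_mul, aeval_X, mul_assoc, mul_comm (weightElt n)]; rfl⟩
    · obtain ⟨r, hr⟩ := exists_weightElt_mul_pf (lam := lam) n
      exact ⟨Finsupp.single (n + 1) (p * r), by
        rw [ofNormalForm_single, map_mul, mul_assoc, ← hr]; rfl⟩

lemma toLaurentPQ_weightElt (n : ℤ) :
    toLaurentPQ 1 0 (weightElt n : PQ k lam) = single n (efPoly lam ^ (-n).toNat) := by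
  have he : toLaurentPQ 1 0 (pe k lam) = single (-1) (efPoly lam) := by
    rw [toLaurentPQ_pe, mul_zero, zero_sub, ← single_sub, efPoly]
    congr 1
    rw [mul_sub, ← C_mul, show -(1 / 4) * lam = -(lam / 4) by ring, C_neg, C_neg]
    ring
  rw [weightElt, map_mul, map_pow, map_pow, he, toLaurentPQ_pf, single_pow, single_pow,
    single_mul_single, one_pow, one_mul]
  congr 1
  simp
  omega

lemma toLaurentPQ_aeval_ph (p : k[X]) :
    toLaurentPQ 1 0 (aeval (ph k lam) p) = single 0 p := by
  rw [← aeval_algHom_apply, toLaurentPQ_ph]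
  induction p using Polynomial.induction_on' with
  | add p q hp hq => rw [map_add, hp, hq, single_add]
  | monomial i c =>
    rw [aeval_monomial, single_pow, ← C_mul_X_pow_eq_monomial]
    simp [-LaurentPolynomial.single_eq_C_mul_T, coe_algebraMap, single_mul_single]

lemma coeff_toLaurentPQ_ofNormalForm (q : ℤ →₀ k[X]) (n : ℤ) :
    (toLaurentPQ 1 0 (ofNormalForm q : PQ k lam)).coeff n =
      q n * efPoly lam ^ (-n).toNat := by
  induction q using Finsupp.induction_linear with
  | zero => simp
  | add p q hp hq => simp [hp, hq, add_mul]
  | single m p =>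
    rw [ofNormalForm_single, map_mul, toLaurentPQ_weightElt, toLaurentPQ_aeval_ph,
      single_mul_single, zero_add, coeff_single, Finsupp.single_apply, Finsupp.single_apply]
    split_ifs with h
    · rw [h]
    · rw [zero_mul]

lemma toLaurentPQ_one_zero_injective :
    Function.Injective (toLaurentPQ 1 0 : PQ k lam → LaurentPolynomial k[X]) := by
  refine (injective_iff_map_eq_zero _).2 fun a ha => ?_
  obtain ⟨q, rfl⟩ := ofNormalForm_surjective a
  have : q = 0 := by
    ext1 n
    have h := coeff_toLaurentPQ_ofNormalForm (lam := lam) q n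
    rw [ha] at h
    exact (mul_eq_zero.1 h.symm).resolve_right (pow_ne_zero _ efPoly_ne_zero)
  rw [this, map_zero]

lemma coeff_toLaurentPQ {N : ℤ} (hN : N ≠ 0) (R : ℤ) (a : PQ k lam) (n : ℤ) (j : ℕ) :
    ((toLaurentPQ N R a).coeff (n * N + j * R)).coeff j =
      ((toLaurentPQ 1 0 a).coeff n).coeff j := by
  rw [← laurentSubst_toLaurentPQ, coeff_laurentSubst hN]

lemma exists_of_coeff_toLaurentPQ_ne_zero {N R m : ℤ} {j : ℕ} {a : PQ k lam}
    (h : ((toLaurentPQ N R a).coeff m).coeff j ≠ 0) : ∃ n : ℤ, m = n * N + j * R := by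
  by_contra! h'
  exact h (laurentSubst_toLaurentPQ N R a ▸ coeff_laurentSubst_eq_zero h' _)

lemma toLaurentPQ_injective {N : ℤ} (hN : N ≠ 0) (R : ℤ) :
    Function.Injective (toLaurentPQ N R : PQ k lam → LaurentPolynomial k[X]) := by
  refine (injective_iff_map_eq_zero _).2 fun a ha => ?_
  refine toLaurentPQ_one_zero_injective ?_
  rw [map_zero]
  refine LaurentPolynomial.ext fun n => Polynomial.ext fun j => ?_
  rw [← coeff_toLaurentPQ hN R, ha]
  rfl

lemma efPoly_pow_dvd_coeff (a : PQ k lam) (n : ℤ) :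
    efPoly lam ^ (-n).toNat ∣ (toLaurentPQ 1 0 a).coeff n := by
  obtain ⟨q, rfl⟩ := ofNormalForm_surjective a
  rw [coeff_toLaurentPQ_ofNormalForm]
  exact dvd_mul_left _ _

/-- An element of `P_λ` whose image involves no `X` is a polynomial in `f`. -/
lemma exists_eq_aeval_pf {a : PQ k lam}
    (h : ∀ (n : ℤ) (j : ℕ), 0 < j → ((toLaurentPQ 1 0 a).coeff n).coeff j = 0) :
    ∃ q : k[X], a = aeval (pf k lam) q := by
  obtain ⟨q, rfl⟩ := ofNormalForm_surjective a
  simp only [coeff_toLaurentPQ_ofNormalForm] at h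
  refine ofNormalForm_induction (P := fun a => ∃ p : k[X], a = aeval (pf k lam) p)
    ⟨0, by simp⟩ ?_ fun n => ?_
  · rintro _ _ ⟨p, rfl⟩ ⟨p', rfl⟩
    exact ⟨p + p', (map_add _ _ _).symm⟩
  by_cases hn : q n = 0
  · exact ⟨0, by simp [hn]⟩
  have hdeg : (q n).natDegree + 2 * (-n).toNat = 0 := by
    rw [← natDegree_efPoly_pow (lam := lam),
      ← natDegree_mul hn (pow_ne_zero _ efPoly_ne_zero)]
    by_contra hpos
    refine hn ((mul_eq_zero.1 ?_).resolve_right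
      (pow_ne_zero (-n).toNat (efPoly_ne_zero (lam := lam))))
    exact leadingCoeff_eq_zero.1 (h n _ (Nat.pos_of_ne_zero hpos))
  have h0 : (-n).toNat = 0 := by omega
  rw [eq_C_of_natDegree_eq_zero (show (q n).natDegree = 0 by omega), weightElt, h0, pow_zero,
    mul_one, aeval_C]
  exact ⟨C ((q n).coeff 0) * X ^ n.toNat, by simp⟩

instance : IsDomain (PQ k lam) :=
  toLaurentPQ_one_zero_injective.isDomain (toLaurentPQ 1 0 : PQ k lam →ₐ[k] _)

end NormalForm

/-! ### The bracket in Laurent coordinates and local nilpotency -/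

section Bracket

open Polynomial AddMonoidAlgebra

lemma iterate_laurentBr_T_eq_zero {k : Type*} [Field k] (i : ℕ) : ∀ {y : LaurentPolynomial k[X]},
    (∀ (n : ℤ) (j : ℕ), i ≤ j → (y.coeff n).coeff j = 0) →
      (laurentBr (2 : k) 0 (single 1 1))^[i] y = 0 := by
  induction i with
  | zero =>
    intro y h
    exact LaurentPolynomial.ext fun n => Polynomial.ext fun j => h n j j.zero_le
  | succ i ih =>
    intro y h
    rw [Function.iterate_succ_apply]
    refine ih fun n j hj => ?_
    have h1 : laurentBr (2 : k) 0 (single 1 1) y = single 1 (C 2) * coeffDeriv y := by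
      simp [-LaurentPolynomial.single_eq_C_mul_T, laurentBr, ← mul_assoc, single_mul_single]
    obtain ⟨m, rfl⟩ : ∃ m, n = 1 + m := ⟨n - 1, by ring⟩
    rw [h1, coeff_single_mul_add, coeff_coeffDeriv, coeff_C_mul, coeff_derivative,
      h m (j + 1) (by omega), zero_mul, mul_zero]

namespace PoissonBr

variable {k : Type*} [Field k] {lam : k} (B : PoissonBr k lam)

lemma swap (a b : PQ k lam) : B.br a b = -B.br b a := by
  have h := B.alternate (a + b)
  rw [B.add_left, B.add_right, B.add_right, B.alternate, B.alternate, zero_add, add_zero] at h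
  exact eq_neg_of_add_eq_zero_left h

lemma br_algebraMap (a : PQ k lam) (c : k) : B.br a (algebraMap k _ c) = 0 := by
  have h : B.br a 1 = 0 := by
    have h1 := B.leibniz a 1 1
    rwa [one_mul, mul_one, one_mul, left_eq_add] at h1
  rw [Algebra.algebraMap_eq_smul_one, B.smul_right, h, smul_zero]

lemma laurent_of_generators {a : PQ k lam} {ι : PQ k lam →ₐ[k] LaurentPolynomial k[X]} {c : k}
    {R : ℤ} (he : ι (B.br a (pe k lam)) = laurentBr c R (ι a) (ι (pe k lam)))
    (hh : ι (B.br a (ph k lam)) = laurentBr c R (ι a) (ι (ph k lam)))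
    (hf : ι (B.br a (pf k lam)) = laurentBr c R (ι a) (ι (pf k lam))) (b : PQ k lam) :
    ι (B.br a b) = laurentBr c R (ι a) (ι b) := by
  let S : Subalgebra k (PQ k lam) :=
    { carrier := {b | ι (B.br a b) = laurentBr c R (ι a) (ι b)}
      mul_mem' := fun {x y} hx hy => by
        simp only [Set.mem_ofPred_eq] at hx hy ⊢
        rw [B.leibniz, map_mul ι x y, laurentBr_mul, map_add, map_mul, map_mul, hx, hy]
      add_mem' := fun {x y} hx hy => by
        simp only [Set.mem_ofPred_eq] at hx hy ⊢
        rw [B.add_right, map_add, map_add, laurentBr_add_right, hx, hy]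
      algebraMap_mem' := fun r => by
        simp only [Set.mem_ofPred_eq]
        rw [B.br_algebraMap, map_zero, AlgHom.commutes, laurentBr_algebraMap] }
  exact subalgebra_PQ_eq_top (S := S) he hh hf b

variable [CharZero k] {N : ℤ} (R : ℤ)

lemma laurent_of_ph_of_pf {a : PQ k lam} {c : k}
    (hh : toLaurentPQ N R (B.br a (ph k lam)) =
      laurentBr c R (toLaurentPQ N R a) (toLaurentPQ N R (ph k lam)))
    (hf : toLaurentPQ N R (B.br a (pf k lam)) =
      laurentBr c R (toLaurentPQ N R a) (toLaurentPQ N R (pf k lam))) (b : PQ k lam) :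
    toLaurentPQ N R (B.br a b) = laurentBr c R (toLaurentPQ N R a) (toLaurentPQ N R b) := by
  refine B.laurent_of_generators ?_ hh hf b
  have h4 : (4 : PQ k lam) = algebraMap k _ 4 := (map_ofNat _ 4).symm
  have h1 : toLaurentPQ N R (B.br a (4 * pe k lam * pf k lam + ph k lam ^ 2)) =
      laurentBr c R (toLaurentPQ N R a)
        (toLaurentPQ N R (4 * pe k lam * pf k lam + ph k lam ^ 2)) := by
    rw [pe_mul_pf_add_sq, B.br_algebraMap, map_zero, AlgHom.commutes, laurentBr_algebraMap]
  rw [h4, sq (ph k lam), B.add_right, B.leibniz, B.leibniz, B.leibniz, B.br_algebraMap] at h1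
  simp only [map_add, map_mul, laurentBr_add_right, laurentBr_mul, AlgHom.commutes,
    laurentBr_algebraMap, hh, hf, zero_mul, add_zero] at h1
  have h5 := add_right_cancel h1
  have h6 := add_left_cancel h5
  refine mul_left_cancel₀ ?_ (mul_right_cancel₀ ?_ h6)
  · simp [-LaurentPolynomial.single_eq_C_mul_T]
  · rw [toLaurentPQ_pf]
    intro h0
    have := congrArg (fun x : LaurentPolynomial k[X] => x.coeff N) h0
    simp at this

lemma toLaurentPQ_br (hN : N ≠ 0) (a b : PQ k lam) :
    toLaurentPQ N R (B.br a b) =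
      laurentBr (2 / (N : k)) R (toLaurentPQ N R a) (toLaurentPQ N R b) := by
  have hN' : (N : k) ≠ 0 := by exact_mod_cast hN
  have symm {a b : PQ k lam} (h : toLaurentPQ N R (B.br a b) =
      laurentBr (2 / (N : k)) R (toLaurentPQ N R a) (toLaurentPQ N R b)) :
      toLaurentPQ N R (B.br b a) =
        laurentBr (2 / (N : k)) R (toLaurentPQ N R b) (toLaurentPQ N R a) := by
    rw [B.swap, laurentBr_swap, map_neg, h]
  have diag (a : PQ k lam) : toLaurentPQ N R (B.br a a) =
      laurentBr (2 / (N : k)) R (toLaurentPQ N R a) (toLaurentPQ N R a) := by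
    rw [B.alternate, map_zero, laurentBr_self]
  have hhf : toLaurentPQ N R (B.br (ph k lam) (pf k lam)) = laurentBr (2 / (N : k)) R
      (toLaurentPQ N R (ph k lam)) (toLaurentPQ N R (pf k lam)) := by
    rw [B.br_hf, map_mul, map_neg, map_ofNat, toLaurentPQ_pf, toLaurentPQ_ph, laurentBr]
    have h2 : (2 : LaurentPolynomial k[X]) = single 0 (C 2) := rfl
    have h3 : (N : k[X]) = C (N : k) := by simp
    simp only [coeffDeriv_single, eulerDeriv_single, derivative_one, derivative_X, single_zero,
      mul_zero, zero_sub, single_mul_single, h2, one_mul, zsmul_eq_mul, mul_one, h3]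
    have h4 : (single 0 (C 2) * single N 1 : LaurentPolynomial k[X]) =
        single (-R) (C (2 / (N : k))) * single (R + N) (C (N : k)) := by
      rw [single_mul_single, single_mul_single, ← C_mul,
        div_mul_cancel₀ _ hN', neg_add_cancel_left, zero_add, mul_one]
    linear_combination -h4
  have hh := B.laurent_of_ph_of_pf R (diag (ph k lam)) hhf
  have hf := B.laurent_of_ph_of_pf R (symm hhf) (diag (pf k lam))
  exact B.laurent_of_ph_of_pf R (symm (hh a)) (symm (hf a)) b

lemma toLaurentPQ_iterate_br (hN : N ≠ 0) (a b : PQ k lam) (i : ℕ) :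
    toLaurentPQ N R ((B.br a)^[i] b) =
      (laurentBr (2 / (N : k)) R (toLaurentPQ N R a))^[i] (toLaurentPQ N R b) := by
  induction i with
  | zero => rfl
  | succ i ih => rw [Function.iterate_succ_apply', Function.iterate_succ_apply',
      B.toLaurentPQ_br R hN, ih]

lemma exists_iterate_br_pf_eq_zero (y : PQ k lam) : ∃ i, (B.br (pf k lam))^[i] y = 0 := by
  set x := toLaurentPQ 1 0 y
  refine ⟨x.coeff.support.sup (fun n => (x.coeff n).natDegree + 1),
    toLaurentPQ_one_zero_injective ?_⟩
  rw [B.toLaurentPQ_iterate_br 0 one_ne_zero, map_zero, Int.cast_one, div_one, toLaurentPQ_pf]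
  refine iterate_laurentBr_T_eq_zero _ fun n j hj => ?_
  by_cases hn : x.coeff n = 0
  · simp [x, hn]
  · exact coeff_eq_zero_of_natDegree_lt
      ((Finset.le_sup (f := fun n => (x.coeff n).natDegree + 1)
        (Finsupp.mem_support_iff.2 hn)).trans hj)

end PoissonBr

end Bracket

/-! ### Leading coefficients of images of `f` -/

section LeadingCoeff

open Polynomial AddMonoidAlgebra

variable {k : Type*} [Field k] {lam : k} [CharZero k] {B : PoissonBr k lam} (φ : PAut B)
  {N R α : ℤ}

lemma exists_iterate_br_image_pf_eq_zero (y : PQ k lam) :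
    ∃ i, (B.br (φ.val (pf k lam)))^[i] y = 0 := by
  obtain ⟨z, rfl⟩ := φ.val.surjective y
  obtain ⟨i, hi⟩ := B.exists_iterate_br_pf_eq_zero z
  refine ⟨i, ?_⟩
  have h : Function.Semiconj φ.val (B.br (pf k lam)) (B.br (φ.val (pf k lam))) :=
    fun z => φ.2 _ z
  rw [← (h.iterate_right i).eq, hi, map_zero]

/-- The numerical constraint on a root of the leading coefficient of an image of `f`, imposed by
a test element `y`. -/
lemma exists_test_eq_zero (hN : N ≠ 0) (hF : DegLE α (toLaurentPQ N R (φ.val (pf k lam))))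
    {t : k} {m : ℕ} {s : k[X]} (hs : s.eval t ≠ 0)
    (hp : (toLaurentPQ N R (φ.val (pf k lam))).coeff α = (X - C t) ^ m * s)
    {y : PQ k lam} {b : ℤ} {n : ℕ} {r : k[X]} (hy : DegLE b (toLaurentPQ N R y))
    (hr : r.eval t ≠ 0) (hyb : (toLaurentPQ N R y).coeff b = (X - C t) ^ n * r) :
    ∃ j : ℕ, α * n - b * m + j * (m * R - α) = 0 := by
  by_contra! h
  obtain ⟨i, hi⟩ := exists_iterate_br_image_pf_eq_zero φ y
  have hc : 2 / (N : k) ≠ 0 := by simp [hN]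
  refine iterate_laurentBr_ne_zero hc hF hs hp i hy hr hyb h ?_
  rw [← B.toLaurentPQ_iterate_br R hN, hi, map_zero]

lemma lt_mul_of_root (hN : 0 < N) (hF : DegLE α (toLaurentPQ N R (φ.val (pf k lam))))
    {t : k} {m : ℕ} (hm : 0 < m) {s : k[X]} (hs : s.eval t ≠ 0)
    (hp : (toLaurentPQ N R (φ.val (pf k lam))).coeff α = (X - C t) ^ m * s) : α < m * R := by
  obtain ⟨j, hj⟩ := exists_test_eq_zero φ hN.ne' hF hs hp (y := pf k lam) (b := N) (n := 0)
    (r := 1) (by rw [toLaurentPQ_pf]; exact degLE_single _ _) (by simp) (by simp)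
  by_contra! h
  have h1 : 0 < N * m := by positivity
  have h2 : (j : ℤ) * (m * R - α) ≤ 0 :=
    mul_nonpos_of_nonneg_of_nonpos (by positivity) (by linarith)
  push_cast at hj
  linarith

lemma weight_le_of_coeff_ne_zero (hN : N ≠ 0) {a : PQ k lam} (ha : DegLE α (toLaurentPQ N R a))
    {n : ℤ} {j : ℕ} (h : ((toLaurentPQ 1 0 a).coeff n).coeff j ≠ 0) : n * N + j * R ≤ α := by
  by_contra! h'
  refine h ?_
  rw [← coeff_toLaurentPQ hN R, ha _ h', Polynomial.coeff_zero]

lemma natDegree_coeff_le (hN : 0 < N) (hNR : N ≤ R) {a : PQ k lam}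
    (ha : DegLE α (toLaurentPQ N R a)) (h0 : (toLaurentPQ N R a).coeff α ≠ 0) :
    ((toLaurentPQ N R a).coeff α).natDegree * (2 * R - N) ≤ 2 * α := by
  set j := ((toLaurentPQ N R a).coeff α).natDegree with hj
  have hjc : ((toLaurentPQ N R a).coeff α).coeff j ≠ 0 := by
    rwa [hj, coeff_natDegree, Polynomial.leadingCoeff_ne_zero]
  obtain ⟨n, hn⟩ := exists_of_coeff_toLaurentPQ_ne_zero hjc
  rw [hn, coeff_toLaurentPQ hN.ne'] at hjc
  have hn0 : (toLaurentPQ 1 0 a).coeff n ≠ 0 := fun h => hjc (by rw [h, Polynomial.coeff_zero])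
  have hdvd := natDegree_le_of_dvd (efPoly_pow_dvd_coeff a n) hn0
  rw [natDegree_efPoly_pow] at hdvd
  have hle := weight_le_of_coeff_ne_zero hN.ne' ha (n := n)
    (j := ((toLaurentPQ 1 0 a).coeff n).natDegree)
    (by rwa [coeff_natDegree, Polynomial.leadingCoeff_ne_zero])
  have hjle : ((toLaurentPQ 1 0 a).coeff n).natDegree ≤ j := by
    rw [hn] at hle
    have : ((((toLaurentPQ 1 0 a).coeff n).natDegree : ℕ) : ℤ) ≤ j :=
      le_of_mul_le_mul_right (by linarith) (hN.trans_le hNR)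
    exact_mod_cast this
  have h3 : 0 ≤ (2 * n + j) * N := mul_nonneg (by omega) hN.le
  rw [hn]
  linarith

lemma exists_top_coeff_eq [IsAlgClosed k] (hN : 0 < N) (hNR : N ≤ R)
    (hF : DegLE α (toLaurentPQ N R (φ.val (pf k lam))))
    (h0 : (toLaurentPQ N R (φ.val (pf k lam))).coeff α ≠ 0) :
    ∃ (c t : k) (m : ℕ), c ≠ 0 ∧
      (toLaurentPQ N R (φ.val (pf k lam))).coeff α = (X - C t) ^ m * C c := by
  have hdeg := natDegree_coeff_le hN hNR hF h0
  set p := (toLaurentPQ N R (φ.val (pf k lam))).coeff α with hp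
  by_cases hp0 : p.natDegree = 0
  · refine ⟨p.coeff 0, 0, 0, fun h => h0 ?_, ?_⟩
    · rw [eq_C_of_natDegree_eq_zero hp0, h, C_0]
    · rw [pow_zero, one_mul]
      exact eq_C_of_natDegree_eq_zero hp0
  have root_eq {q : k[X]} (hq : q.natDegree ≠ 0) : ∃ (t : k) (m : ℕ) (s : k[X]), 0 < m ∧
      q = (X - C t) ^ m * s ∧ s.eval t ≠ 0 := by
    have hq0 : q ≠ 0 := by rintro rfl; simp at hq
    obtain ⟨t, ht⟩ := IsAlgClosed.exists_root q fun h => hq (natDegree_eq_of_degree_eq_some h)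
    obtain ⟨s, hs, hs'⟩ := exists_eq_pow_rootMultiplicity_mul_and_not_dvd q hq0 t
    exact ⟨t, _, s, (rootMultiplicity_pos hq0).2 ht, hs, fun h => hs' (dvd_iff_isRoot.2 h)⟩
  obtain ⟨t, m, s, hm, hps, hs⟩ := root_eq hp0
  have hs0 : s ≠ 0 := by rintro rfl; simp at hs
  by_cases hsd : s.natDegree = 0
  · refine ⟨s.coeff 0, t, m, fun h => hs0 ?_, ?_⟩
    · rw [eq_C_of_natDegree_eq_zero hsd, h, C_0]
    · rw [← eq_C_of_natDegree_eq_zero hsd, hps]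
  exfalso
  obtain ⟨t', m', s', hm', hss, hs'⟩ := root_eq hsd
  have htt : t' ≠ t := by
    rintro rfl
    rw [hss, eval_mul, eval_pow] at hs
    simp [hm'.ne'] at hs
  have h1 := lt_mul_of_root φ hN hF hm hs (hp.symm.trans hps)
  have h2 := lt_mul_of_root φ hN hF (t := t') (s := s' * (X - C t) ^ m) hm'
    (by simpa [hs', sub_eq_zero, hm.ne'] using htt) (hp.symm.trans (by rw [hps, hss]; ring))
  have h3 : m + m' ≤ p.natDegree := by
    have hs'0 : s' ≠ 0 := by rintro rfl; simp at hs'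
    rw [hps, hss, ((monic_X_sub_C t).pow m).natDegree_mul'
      (mul_ne_zero (pow_ne_zero _ (X_sub_C_ne_zero _)) hs'0),
      ((monic_X_sub_C t').pow m').natDegree_mul' hs'0]
    simp [← add_assoc]
  have h4 : ((m : ℤ) + m') * R ≤ p.natDegree * R :=
    mul_le_mul_of_nonneg_right (by exact_mod_cast h3) (hN.le.trans hNR)
  have h5 : (p.natDegree : ℤ) * N ≤ p.natDegree * R :=
    mul_le_mul_of_nonneg_left hNR (by positivity)
  linarith

end LeadingCoeff

/-! ### The action of `Δ_g` and `τ` on Laurent coordinates -/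

section Action

open Polynomial AddMonoidAlgebra

variable {k : Type*} [Field k] {lam : k}

lemma aeval_single_one_monomial (N : ℤ) (r : ℕ) (γ : k) :
    aeval (single N 1 : LaurentPolynomial k[X]) (monomial r γ) = single (r * N) (C γ) := by
  simp [-LaurentPolynomial.single_eq_C_mul_T, aeval_monomial, coe_algebraMap,
    single_mul_single, single_pow]

lemma DegLE.smul {a : ℤ} {x : LaurentPolynomial k[X]} (hx : DegLE a x) (c : k) :
    DegLE a (c • x) := fun n hn => by
  rw [AddMonoidAlgebra.coeff_smul, Finsupp.smul_apply, hx n hn, smul_zero]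

lemma DegLE.pow {a : ℤ} {x : LaurentPolynomial k[X]} (hx : DegLE a x) (d : ℕ) :
    DegLE (d * a) (x ^ d) := by
  induction d with
  | zero =>
    rw [pow_zero, Nat.cast_zero, zero_mul, one_def]
    exact degLE_single _ _
  | succ d ih =>
    rw [pow_succ]
    exact (ih.mul hx).mono (by push_cast; linarith)

lemma DegLE.aeval {x : LaurentPolynomial k[X]} (hx : DegLE 1 x) (p : k[X]) :
    DegLE p.natDegree (aeval x p) := by
  rw [aeval_eq_sum_range]
  refine Finset.sum_induction _ (DegLE _) (fun _ _ => DegLE.add) (fun _ _ => rfl) fun i hi => ?_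
  refine ((hx.pow i).smul _).mono ?_
  have := Finset.mem_range.1 hi
  omega

variable [CharZero k]

lemma algHom_PQ_ext_of_ph_of_pf {A : Type*} [CommRing A] [IsDomain A] [Algebra k A]
    {φ ψ : PQ k lam →ₐ[k] A} (hh : φ (ph k lam) = ψ (ph k lam))
    (hf : φ (pf k lam) = ψ (pf k lam)) (h0 : ψ (pf k lam) ≠ 0) : φ = ψ := by
  refine algHom_PQ_ext ?_ hh hf
  have h1 := congrArg φ (pe_mul_pf_add_sq (lam := lam))
  have h2 := congrArg ψ (pe_mul_pf_add_sq (lam := lam))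
  have h4 : (4 : A) ≠ 0 := by
    rw [← map_ofNat (algebraMap k A) 4]
    simp
  simp only [map_add, map_mul, map_pow, map_ofNat, AlgHom.commutes, hh, hf] at h1 h2
  exact mul_left_cancel₀ h4 (mul_right_cancel₀ h0 (add_right_cancel (h1.trans h2.symm)))

lemma toLaurentPQ_pf_ne_zero (N R : ℤ) : toLaurentPQ N R (pf k lam) ≠ 0 := by
  rw [toLaurentPQ_pf]
  intro h0
  simpa using congrArg (fun x : LaurentPolynomial k[X] => x.coeff N) h0

lemma toLaurentPQ_aeval_pf (N R : ℤ) (q : k[X]) : toLaurentPQ N R (aeval (pf k lam) q) =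
    aeval (single N 1) q := by
  rw [← aeval_algHom_apply, toLaurentPQ_pf]

/-- In suitable coordinates, `Δ_g` with `g = γ x ^ r` acts as a translation of `X`. -/
lemma coeff_toLaurentPQ_delta {B : PoissonBr k lam} {D : PAut B} {r : ℕ} {γ : k}
    (hD : IsDelta B (monomial r γ) D) {N R : ℤ} (hR : R = N * (r + 1)) (a : PQ k lam) (n : ℤ) :
    (toLaurentPQ N R (D.val a)).coeff n = taylor (2 * γ) ((toLaurentPQ N R a).coeff n) := by
  have h : (toLaurentPQ N R).comp (D.val : PQ k lam →ₐ[k] PQ k lam) =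
      (mapAlgHom ℤ (taylorAlgHom (2 * γ))).comp (toLaurentPQ N R) := by
    refine algHom_PQ_ext_of_ph_of_pf ?_ ?_ ?_
    · change toLaurentPQ N R (D.val (ph k lam)) = mapAlgHom ℤ _ (toLaurentPQ N R (ph k lam))
      have h2 : (2 : LaurentPolynomial k[X]) = single 0 (C 2) := rfl
      rw [hD.2.1, toLaurentPQ_ph, mapAlgHom_single, map_add, map_mul, map_mul,
        toLaurentPQ_aeval_pf, aeval_single_one_monomial, toLaurentPQ_ph, toLaurentPQ_pf, map_ofNat,
        h2, single_mul_single, single_mul_single, one_mul, ← C_mul, zero_add,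
        show N + r * N = R by rw [hR]; ring, ← single_add]
      simp
    · change toLaurentPQ N R (D.val (pf k lam)) = mapAlgHom ℤ _ (toLaurentPQ N R (pf k lam))
      rw [hD.2.2, toLaurentPQ_pf, mapAlgHom_single, map_one]
    · change mapAlgHom ℤ _ (toLaurentPQ N R (pf k lam)) ≠ 0
      rw [toLaurentPQ_pf, mapAlgHom_single, map_one, ← toLaurentPQ_pf (lam := lam) N R]
      exact toLaurentPQ_pf_ne_zero N R
  have h' := congrArg (fun x : LaurentPolynomial k[X] => x.coeff n) (DFunLike.congr_fun h a)
  simpa using h'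

lemma degLE_toLaurentPQ_pe : DegLE 1 (toLaurentPQ 1 1 (pe k lam)) := by
  rw [toLaurentPQ_pe]
  exact ((degLE_single _ _).mono (by norm_num)).sub ((degLE_single _ _).mono (by norm_num))

lemma degLE_toLaurentPQ_pf : DegLE 1 (toLaurentPQ 1 1 (pf k lam)) := by
  rw [toLaurentPQ_pf]
  exact degLE_single _ _

variable {B : PoissonBr k lam} {τ : PAut B}

lemma IsTau.degLE (hτ : IsTau B τ) {d : ℤ} {a : PQ k lam} (ha : DegLE d (toLaurentPQ 1 1 a)) :
    DegLE d (toLaurentPQ 1 1 (τ.val a)) := by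
  obtain ⟨q, rfl⟩ := ofNormalForm_surjective a
  refine ofNormalForm_induction (P := fun a => DegLE d (toLaurentPQ 1 1 (τ.val a)))
    (by simp [DegLE]) (fun a b ha hb => by rw [map_add, map_add]; exact ha.add hb) fun n => ?_
  by_cases hq : q n = 0
  · simp [hq, DegLE]
  have hle := weight_le_of_coeff_ne_zero one_ne_zero ha (n := n)
    (j := (q n * efPoly lam ^ (-n).toNat).natDegree) (by
      rw [coeff_toLaurentPQ_ofNormalForm, coeff_natDegree, Polynomial.leadingCoeff_ne_zero]
      exact mul_ne_zero hq (pow_ne_zero _ efPoly_ne_zero))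
  rw [natDegree_mul hq (pow_ne_zero _ efPoly_ne_zero), natDegree_efPoly_pow] at hle
  have h1 : DegLE (q n).natDegree (toLaurentPQ 1 1 (τ.val (aeval (ph k lam) (q n)))) := by
    rw [← aeval_algHom_apply, ← aeval_algHom_apply, hτ.2.1, map_neg, toLaurentPQ_ph, ← single_neg]
    exact (degLE_single _ _).aeval _
  rw [map_mul, map_mul, weightElt, map_mul, map_mul, map_pow, map_pow, map_pow, map_pow, hτ.1,
    hτ.2.2]
  exact (h1.mul ((degLE_toLaurentPQ_pe.pow _).mul (degLE_toLaurentPQ_pf.pow _))).mono (by omega)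

lemma IsTau.coeff_of_top (hτ : IsTau B τ) {d : ℕ} (hd : 0 < d) {a : PQ k lam}
    (ha : DegLE d (toLaurentPQ 1 1 a)) {c : k}
    (hc : (toLaurentPQ 1 1 a).coeff d = X ^ (2 * d) * C c) :
    (toLaurentPQ 1 1 (τ.val a)).coeff d = C ((-4) ^ d * c) := by
  have he : DegLE d (toLaurentPQ 1 1 (pe k lam ^ d)) := by
    rw [map_pow]
    simpa using (degLE_toLaurentPQ_pe (lam := lam)).pow d
  have hed : (toLaurentPQ 1 1 (pe k lam ^ d)).coeff d = C ((-(1 / 4)) ^ d) * X ^ (2 * d) := by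
    clear ha hc he hd
    induction d with
    | zero => simp [-LaurentPolynomial.single_eq_C_mul_T, one_def]
    | succ d ih =>
      have h1 : DegLE d (toLaurentPQ 1 1 (pe k lam ^ d)) := by
        rw [map_pow]
        simpa using (degLE_toLaurentPQ_pe (lam := lam)).pow d
      rw [pow_succ (pe k lam), map_mul]
      push_cast
      rw [h1.coeff_mul degLE_toLaurentPQ_pe, ih, toLaurentPQ_pe]
      simp [-LaurentPolynomial.single_eq_C_mul_T, coeff_single]
      ring
  obtain ⟨d, rfl⟩ : ∃ d', d = d' + 1 := ⟨d - 1, by omega⟩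
  set c' := (-4) ^ (d + 1) * c with hc'
  have hcc : (-(1 / 4)) ^ (d + 1) * c' = c := by
    rw [hc', ← mul_assoc, ← mul_pow]
    norm_num
  have hsub : DegLE d (toLaurentPQ 1 1 (a - c' • pe k lam ^ (d + 1))) := by
    intro n hn
    rw [map_sub, map_smul, AddMonoidAlgebra.coeff_sub, Finsupp.sub_apply,
      AddMonoidAlgebra.coeff_smul, Finsupp.smul_apply]
    rcases (show ((d + 1 : ℕ) : ℤ) ≤ n by push_cast; omega).eq_or_lt with rfl | hn
    · rw [hc, hed, smul_eq_C_mul, ← mul_assoc, ← C_mul, mul_comm c', hcc]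
      ring
    · rw [ha n hn, he n hn, smul_zero, sub_zero]
  have h := hτ.degLE hsub (d + 1 : ℕ) (by push_cast; omega)
  rw [map_sub, map_smul, map_pow, hτ.1, map_sub, map_smul, AddMonoidAlgebra.coeff_sub,
    Finsupp.sub_apply, AddMonoidAlgebra.coeff_smul, Finsupp.smul_apply, sub_eq_zero] at h
  rw [h, map_pow, toLaurentPQ_pf, single_pow]
  simp [smul_eq_C_mul]

end Action

/-! ### Lowering the degree of the image of `f` -/

section Reduction

open Polynomial AddMonoidAlgebra

variable {k : Type*} [Field k]

lemma taylor_X_sub_C_pow_mul_C (t c : k) (m : ℕ) :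
    taylor t ((X - C t) ^ m * C c) = X ^ m * C c := by
  rw [taylor_mul, taylor_pow, map_sub, taylor_X, taylor_C, taylor_C, add_sub_cancel_right]

variable [CharZero k] {lam : k} {B : PoissonBr k lam}

lemma degLE_toLaurentPQ_delta {D : PAut B} {r : ℕ} {γ : k} (hD : IsDelta B (monomial r γ) D)
    {N R α : ℤ} (hR : R = N * (r + 1)) {a : PQ k lam} (ha : DegLE α (toLaurentPQ N R a)) :
    DegLE α (toLaurentPQ N R (D.val a)) := fun n hn => by
  rw [coeff_toLaurentPQ_delta hD hR, ha n hn, map_zero]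

variable [IsAlgClosed k] {G : Subgroup (PAut B)}

/-- The top component of an image of `f` can be made a power of `f`. -/
lemma exists_mul_top_coeff_eq_C {τ : PAut B} (hτ : IsTau B τ) (hτG : τ ∈ G)
    (hG : ∀ g, ∃ D ∈ G, IsDelta B g D) (φ : PAut B) {d : ℕ}
    (hF : DegLE d (toLaurentPQ 1 1 (φ.val (pf k lam))))
    (h0 : (toLaurentPQ 1 1 (φ.val (pf k lam))).coeff d ≠ 0) :
    ∃ σ ∈ G, DegLE d (toLaurentPQ 1 1 ((σ * φ).val (pf k lam))) ∧
      ∃ c ≠ 0, (toLaurentPQ 1 1 ((σ * φ).val (pf k lam))).coeff d = C c := by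
  obtain ⟨c, t, m, hc, hp⟩ := exists_top_coeff_eq φ one_pos le_rfl hF h0
  obtain ⟨D, hDG, hD⟩ := hG (monomial 0 (t / 2))
  have hF' : DegLE d (toLaurentPQ 1 1 ((D * φ).val (pf k lam))) :=
    degLE_toLaurentPQ_delta hD (by norm_num) hF
  have hp' : (toLaurentPQ 1 1 ((D * φ).val (pf k lam))).coeff d = X ^ m * C c := by
    rw [← taylor_X_sub_C_pow_mul_C t, ← hp]
    have h := coeff_toLaurentPQ_delta hD (N := 1) (R := 1) (by norm_num) (φ.val (pf k lam)) d
    rwa [mul_div_cancel₀ _ (two_ne_zero' k)] at h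
  rcases m.eq_zero_or_pos with rfl | hm
  · exact ⟨D, hDG, hF', c, hc, by rw [hp', pow_zero, one_mul]⟩
  have hpX : (toLaurentPQ 1 1 ((D * φ).val (pf k lam))).coeff d = (X - C 0) ^ m * C c := by
    rw [hp', C_0, sub_zero]
  have hce : (C c : k[X]).eval 0 ≠ 0 := by rwa [eval_C]
  have hmd := lt_mul_of_root (D * φ) one_pos hF' hm hce hpX
  have hdeg := natDegree_coeff_le one_pos le_rfl hF' (by
    rw [hp']; exact mul_ne_zero (pow_ne_zero _ X_ne_zero) (C_ne_zero.2 hc))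
  rw [hp', natDegree_mul_C hc, natDegree_X_pow] at hdeg
  have hm2 : m = 2 * d := by
    by_contra hne
    obtain ⟨j, hj⟩ := exists_test_eq_zero (D * φ) one_ne_zero hF' hce hpX
      (y := pe k lam) (b := 1) (n := 2) (r := C (-(1 / 4))) degLE_toLaurentPQ_pe
      (by simp) (by
        rw [toLaurentPQ_pe]
        simp [-LaurentPolynomial.single_eq_C_mul_T, coeff_single])
    have h1 : 0 ≤ (j : ℤ) * (m * 1 - d) := mul_nonneg (by positivity) (by linarith)
    push_cast at hj
    omega
  subst hm2
  refine ⟨τ * D, mul_mem hτG hDG, hτ.degLE hF', (-4) ^ d * c, by simp [hc], ?_⟩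
  exact hτ.coeff_of_top (by omega) hF' hp'

/-- If the top component of an image of `f` is a power of `f`, then the image is a polynomial in
`f`, or its degree can be lowered. -/
lemma exists_mul_degLE_pred (hG : ∀ g, ∃ D ∈ G, IsDelta B g D) (φ : PAut B) {d : ℤ}
    (hF : DegLE d (toLaurentPQ 1 1 (φ.val (pf k lam)))) {c : k} (hc : c ≠ 0)
    (htop : (toLaurentPQ 1 1 (φ.val (pf k lam))).coeff d = C c) :
    (∃ q : k[X], φ.val (pf k lam) = aeval (pf k lam) q) ∨
      ∃ σ ∈ G, DegLE (d - 1) (toLaurentPQ 1 1 ((σ * φ).val (pf k lam))) := by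
  set F := φ.val (pf k lam) with hFdef
  by_cases hS : ∀ (n : ℤ) (j : ℕ), 0 < j → ((toLaurentPQ 1 0 F).coeff n).coeff j = 0
  · exact Or.inl (exists_eq_aeval_pf hS)
  right
  have hlt {n : ℤ} {j : ℕ} (hj : 0 < j) (h : ((toLaurentPQ 1 0 F).coeff n).coeff j ≠ 0) :
      n + j < d := by
    have hle := weight_le_of_coeff_ne_zero one_ne_zero hF h
    refine lt_of_le_of_ne (by linarith) fun heq => h ?_
    rw [← coeff_toLaurentPQ one_ne_zero 1, mul_one, mul_one, heq, htop, coeff_C, if_neg hj.ne']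
  obtain ⟨n₀, j₀, hj₀, hcoef₀, hmin⟩ : ∃ (n₀ : ℤ) (j₀ : ℕ), 0 < j₀ ∧
      ((toLaurentPQ 1 0 F).coeff n₀).coeff j₀ ≠ 0 ∧ ∀ (n : ℤ) (j : ℕ), 0 < j →
        ((toLaurentPQ 1 0 F).coeff n).coeff j ≠ 0 → (d - n₀) * j ≤ (d - n) * j₀ := by
    let S : Finset (Σ _ : ℤ, ℕ) := (toLaurentPQ 1 0 F).coeff.support.sigma
      fun n => ((toLaurentPQ 1 0 F).coeff n).support.filter (0 < ·)
    have hmem (x : Σ _ : ℤ, ℕ) :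
        x ∈ S ↔ 0 < x.2 ∧ ((toLaurentPQ 1 0 F).coeff x.1).coeff x.2 ≠ 0 := by
      simp only [S, Finset.mem_sigma, Finset.mem_filter, Polynomial.mem_support_iff,
        Finsupp.mem_support_iff]
      refine ⟨fun h => ⟨h.2.2, h.2.1⟩, fun h => ⟨fun h' => h.2 ?_, h.2, h.1⟩⟩
      rw [h', Polynomial.coeff_zero]
    push Not at hS
    obtain ⟨n, j, hj, hnj⟩ := hS
    obtain ⟨⟨n₀, j₀⟩, h₀, hmin⟩ := S.exists_min_image (fun x => ((d - x.1 : ℤ) : ℚ) / x.2)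
      ⟨⟨n, j⟩, (hmem _).2 ⟨hj, hnj⟩⟩
    have h₀' := (hmem _).1 h₀
    refine ⟨n₀, j₀, h₀'.1, h₀'.2, fun n j hj hnj => ?_⟩
    have h := hmin ⟨n, j⟩ ((hmem _).2 ⟨hj, hnj⟩)
    rw [div_le_div_iff₀ (by exact_mod_cast h₀'.1) (by exact_mod_cast hj)] at h
    exact_mod_cast h
  have hn₀ := hlt hj₀ hcoef₀
  obtain ⟨N, hN⟩ : ∃ N : ℤ, N = j₀ := ⟨_, rfl⟩
  obtain ⟨R, hR⟩ : ∃ R : ℤ, R = d - n₀ := ⟨_, rfl⟩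
  have hN0 : 0 < N := by omega
  have hNR : N < R := by omega
  have hweight {n : ℤ} {j : ℕ} (h : ((toLaurentPQ 1 0 F).coeff n).coeff j ≠ 0) :
      n * N + j * R ≤ d * N := by
    rcases j.eq_zero_or_pos with rfl | hj
    · have := weight_le_of_coeff_ne_zero one_ne_zero hF h
      push_cast at this ⊢
      nlinarith
    · have := hmin n j hj h
      rw [hN, hR]
      linarith
  have hFN : DegLE (d * N) (toLaurentPQ N R F) := by
    intro m hm
    ext j
    rw [Polynomial.coeff_zero]
    by_contra h
    obtain ⟨n, rfl⟩ := exists_of_coeff_toLaurentPQ_ne_zero h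
    rw [coeff_toLaurentPQ hN0.ne'] at h
    exact (hweight h).not_gt hm
  have hp0 : ((toLaurentPQ N R F).coeff (d * N)).coeff 0 = c := by
    have h1 := coeff_toLaurentPQ hN0.ne' R F d 0
    have h2 := coeff_toLaurentPQ one_ne_zero 1 F d 0
    simp only [Nat.cast_zero, zero_mul, add_zero, mul_one] at h1 h2
    rw [h1, ← h2, htop, coeff_C_zero]
  have hpj : ((toLaurentPQ N R F).coeff (d * N)).coeff j₀ ≠ 0 := by
    have h1 := coeff_toLaurentPQ hN0.ne' R F n₀ j₀
    rw [← hN, hR, show n₀ * N + N * (d - n₀) = d * N by ring, ← hR] at h1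
    rwa [h1]
  obtain ⟨c', t, m, hc', hp⟩ := exists_top_coeff_eq φ hN0 hNR.le hFN
    (fun h => hc (by rw [← hp0, h, Polynomial.coeff_zero]))
  rw [← hFdef] at hp
  have hm : 0 < m := by
    by_contra! hm
    obtain rfl : m = 0 := by omega
    rw [hp, pow_zero, one_mul, coeff_C, if_neg hj₀.ne'] at hpj
    exact hpj rfl
  have ht : t ≠ 0 := by
    rintro rfl
    rw [hp, coeff_zero_eq_eval_zero] at hp0
    simp [hm.ne', hc.symm] at hp0
  have hp1 : ((toLaurentPQ N R F).coeff (d * N)).coeff 1 ≠ 0 := by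
    have h1 := coeff_derivative ((toLaurentPQ N R F).coeff (d * N)) 0
    rw [Nat.cast_zero, zero_add, zero_add, mul_one] at h1
    rw [← h1, hp, coeff_zero_eq_eval_zero, derivative_mul, derivative_X_sub_C_pow]
    simp [hm.ne', ht, hc']
  obtain ⟨n, hn⟩ := exists_of_coeff_toLaurentPQ_ne_zero hp1
  rw [Nat.cast_one, one_mul] at hn
  have hdn : 1 < d - n := by
    by_contra! h
    nlinarith
  obtain ⟨r, hr⟩ : ∃ r : ℕ, (r : ℤ) + 1 = d - n := ⟨(d - n - 1).toNat, by omega⟩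
  have hRr : R = N * (r + 1) := by rw [hr]; linarith
  obtain ⟨D, hDG, hD⟩ := hG (monomial r (t / 2))
  refine ⟨D, hDG, ?_⟩
  set F' := (D * φ).val (pf k lam) with hF'
  have hFN' : DegLE (d * N) (toLaurentPQ N R F') := degLE_toLaurentPQ_delta hD hRr hFN
  have hp' : (toLaurentPQ N R F').coeff (d * N) = X ^ m * C c' := by
    rw [← taylor_X_sub_C_pow_mul_C t, ← hp]
    have h := coeff_toLaurentPQ_delta hD hRr F (d * N)
    rwa [mul_div_cancel₀ _ (two_ne_zero' k)] at h
  intro M hM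
  ext j
  rw [Polynomial.coeff_zero]
  by_contra h
  obtain ⟨n', rfl⟩ := exists_of_coeff_toLaurentPQ_ne_zero h
  rw [coeff_toLaurentPQ one_ne_zero] at h
  have hle := weight_le_of_coeff_ne_zero hN0.ne' hFN' h
  rcases j.eq_zero_or_pos with rfl | hj
  · have hn'd : n' = d := by
      push_cast at hle hM
      refine le_antisymm ?_ (by omega)
      exact le_of_mul_le_mul_right (by linarith) hN0
    refine h ?_
    rw [← coeff_toLaurentPQ hN0.ne' R, hn'd]
    simp [hp', coeff_X_pow, hm.ne]
  · have h1 : d ≤ n' + j := by linarith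
    have h2 : 0 < (j : ℤ) * (R - N) := mul_pos (by exact_mod_cast hj) (by linarith)
    nlinarith

end Reduction

/-! ### Automorphisms mapping `f` to a polynomial in `f` -/

section Triangular

open Polynomial AddMonoidAlgebra

variable {k : Type*} [Field k] {lam : k} {B : PoissonBr k lam} {G : Subgroup (PAut B)}

lemma IsDelta.of_C {D : PAut B} {c : k} (hD : IsDelta B (C c) D) :
    D.val (pe k lam) = pe k lam - algebraMap k _ c * ph k lam -
      pf k lam * algebraMap k _ c ^ 2 ∧
    D.val (ph k lam) = ph k lam + 2 * (pf k lam * algebraMap k _ c) ∧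
    D.val (pf k lam) = pf k lam := by
  simpa only [IsDelta, aeval_C] using hD

lemma exists_hyperbolic_mem {τ : PAut B} (hτ : IsTau B τ) (hτG : τ ∈ G)
    (hG : ∀ g, ∃ D ∈ G, IsDelta B g D) {v : k} (hv : v ≠ 0) :
    ∃ σ ∈ G, σ.val (ph k lam) = ph k lam ∧
      σ.val (pf k lam) = algebraMap k _ (-v ^ 2) * pf k lam := by
  obtain ⟨u, hu⟩ : ∃ u, u * v = -1 := ⟨-v⁻¹, by rw [neg_mul, inv_mul_cancel₀ hv]⟩
  obtain ⟨D, hDG, hD⟩ := hG (C v)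
  obtain ⟨D', hDG', hD'⟩ := hG (C u)
  obtain ⟨he, hh, hf⟩ := hD.of_C
  obtain ⟨he', hh', hf'⟩ := hD'.of_C
  obtain ⟨te, th, tf⟩ := hτ
  have huv : algebraMap k (PQ k lam) u * algebraMap k _ v = -1 := by
    rw [← map_mul, hu, map_neg, map_one]
  refine ⟨D * (τ * (D' * (τ * (D * τ)))), mul_mem hDG (mul_mem hτG (mul_mem hDG'
    (mul_mem hτG (mul_mem hDG hτG)))), ?_, ?_⟩
  · change D.val (τ.val (D'.val (τ.val (D.val (τ.val (ph k lam)))))) = _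
    simp only [map_neg, map_add, map_sub, map_mul, map_pow, map_ofNat, AlgEquiv.commutes, te, th,
      tf, he, hh, hf, he', hh']
    generalize algebraMap k (PQ k lam) u = U at *
    generalize algebraMap k (PQ k lam) v = V at *
    clear * - huv
    grind
  · change D.val (τ.val (D'.val (τ.val (D.val (τ.val (pf k lam)))))) = _
    simp only [map_neg, map_add, map_sub, map_mul, map_pow, map_ofNat, AlgEquiv.commutes, te, th,
      tf, he, hh, hf, he', hh', hf']
    generalize algebraMap k (PQ k lam) u = U at *
    generalize algebraMap k (PQ k lam) v = V at *
    clear * - huv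
    grind

lemma natDegree_eq_one_of_map_pf [IsAlgClosed k] {φ : PAut B} {q : k[X]}
    (hφ : φ.val (pf k lam) = aeval (pf k lam) q) : q.natDegree = 1 := by
  obtain ⟨μ, hμ⟩ := IsAlgClosed.exists_pow_nat_eq lam two_pos
  let ε : PQ k lam →ₐ[k] k[X] := liftPQ 0 (C μ) X (by
    rw [mul_zero, zero_mul, zero_add, ← C_pow, hμ, algebraMap_eq])
  have h : X = q.comp (ε (φ.val.symm (pf k lam))) := by
    have h1 := congrArg (fun x => ε (φ.val.symm x)) hφ
    simp only [AlgEquiv.symm_apply_apply, ← aeval_algHom_apply] at h1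
    simpa [ε, aeval_def, comp] using h1
  have h2 := congrArg natDegree h
  rw [natDegree_X, natDegree_comp] at h2
  exact (Nat.eq_one_of_mul_eq_one_right h2.symm)

variable [CharZero k]

lemma pf_ne_zero : pf k lam ≠ 0 :=
  fun h => toLaurentPQ_pf_ne_zero (lam := lam) 1 0 (by rw [h, map_zero])

lemma PAut.ext_of_ph_of_pf {φ ψ : PAut B} (hh : φ.val (ph k lam) = ψ.val (ph k lam))
    (hf : φ.val (pf k lam) = ψ.val (pf k lam)) : φ = ψ := by
  have h : (φ.val : PQ k lam →ₐ[k] PQ k lam) = ψ.val :=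
    algHom_PQ_ext_of_ph_of_pf hh hf (by simpa using pf_ne_zero)
  exact Subtype.ext (AlgEquiv.ext fun x => DFunLike.congr_fun h x)

lemma eq_zero_and_exists_eq_aeval_of_br_pf {u : PQ k lam} {c : k}
    (h : B.br u (pf k lam) = algebraMap k _ c) :
    c = 0 ∧ ∃ r : k[X], u = aeval (pf k lam) r := by
  have h1 := B.toLaurentPQ_br 0 one_ne_zero u (pf k lam)
  rw [h, AlgHom.commutes, toLaurentPQ_pf, laurentBr, coeffDeriv_single, derivative_one,
    single_zero, eulerDeriv_single, neg_zero, one_smul, Int.cast_one, div_one] at h1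
  set x := toLaurentPQ 1 0 u
  have h2 (n : ℤ) : (algebraMap k (LaurentPolynomial k[X]) c).coeff (1 + n) =
      C (-2) * derivative (x.coeff n) := by
    rw [h1, show single 0 (C 2) * (eulerDeriv x * 0 - coeffDeriv x * single 1 1) =
      (single 0 (C 2) * single 1 1 : LaurentPolynomial k[X]) * (-coeffDeriv x) by ring,
      single_mul_single, zero_add, mul_one, coeff_single_mul_add, AddMonoidAlgebra.coeff_neg,
      Finsupp.neg_apply, coeff_coeffDeriv, C_neg]
    ring
  have h3 (n : ℤ) : (algebraMap k (LaurentPolynomial k[X]) c).coeff n =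
      if n = 0 then C c else 0 := by
    rw [coe_algebraMap]
    by_cases hn : n = 0 <;> simp [hn]
  have h4 {n : ℤ} (h5 : C (-2) * derivative (x.coeff n) = 0) (j : ℕ) (hj : 0 < j) :
      (x.coeff n).coeff j = 0 := by
    obtain ⟨j, rfl⟩ := Nat.exists_eq_add_one_of_ne_zero hj.ne'
    have h6 := congrArg (fun p => p.coeff j) h5
    simpa [coeff_derivative, Nat.cast_add_one_ne_zero] using h6
  have hc : c = 0 := by
    have h5 := h2 (-1)
    rw [h3, if_pos (by norm_num)] at h5
    have h6 : x.coeff (-1) = 0 := by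
      refine eq_zero_of_dvd_of_natDegree_lt (efPoly_pow_dvd_coeff u (-1)) ?_
      rw [natDegree_efPoly_pow]
      have h7 := congrArg natDegree h5
      rw [natDegree_C, natDegree_C_mul (by simp), natDegree_derivative] at h7
      omega
    simpa [h6] using h5
  refine ⟨hc, exists_eq_aeval_pf fun n => h4 ?_⟩
  rw [← h2, h3, hc, C_0, ite_self]

variable [IsAlgClosed k]

/-- An automorphism mapping `f` to a polynomial in `f` lies in the subgroup generated by `τ` and
the `Δ_g`. -/
lemma mem_of_map_pf_eq_aeval {τ : PAut B} (hτ : IsTau B τ) (hτG : τ ∈ G)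
    (hG : ∀ g, ∃ D ∈ G, IsDelta B g D) {φ : PAut B} {q : k[X]}
    (hφ : φ.val (pf k lam) = aeval (pf k lam) q) : φ ∈ G := by
  obtain ⟨a, ha, b, rfl⟩ := natDegree_eq_one.1 (natDegree_eq_one_of_map_pf hφ)
  simp only [map_add, map_mul, aeval_C, aeval_X] at hφ
  obtain ⟨hb, r, hr⟩ := eq_zero_and_exists_eq_aeval_of_br_pf (B := B)
    (u := φ.val (ph k lam) - ph k lam) (c := -2 * b / a) (by
      have ha' : algebraMap k (PQ k lam) a ≠ 0 := by simpa using ha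
      have h1 := φ.2 (ph k lam) (pf k lam)
      have h2 : algebraMap k (PQ k lam) a * algebraMap k (PQ k lam) (-2 * b / a) =
          -2 * algebraMap k (PQ k lam) b := by
        rw [← map_mul, mul_div_cancel₀ _ ha, map_mul, map_neg, map_ofNat]
      rw [B.br_hf, hφ, B.add_right, B.leibniz, B.br_algebraMap, B.br_algebraMap, zero_mul,
        add_zero, add_zero, map_mul, map_neg, map_ofNat, hφ] at h1
      have h3 := B.add_left (φ.val (ph k lam) - ph k lam) (ph k lam) (pf k lam)
      rw [sub_add_cancel, B.br_hf] at h3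
      refine mul_left_cancel₀ ha' ?_
      linear_combination (-algebraMap k (PQ k lam) a) * h3 - h1 - h2)
  obtain rfl : b = 0 := by simpa [ha] using hb
  rw [map_zero, add_zero] at hφ
  rw [sub_eq_iff_eq_add] at hr
  have hr0 : r.eval 0 = 0 := by
    obtain ⟨μ, hμ⟩ := IsAlgClosed.exists_pow_nat_eq lam two_pos
    have key {ν : k} (hν : ν ^ 2 = lam) : (r.eval 0 + ν) ^ 2 = lam := by
      let ε : PQ k lam →ₐ[k] k := liftPQ 0 ν 0 (by simp [hν])
      have h1 := congrArg (fun x => ε (φ.val x)) (pe_mul_pf_add_sq (lam := lam))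
      simp only [map_add, map_mul, map_pow, hr, hφ, AlgEquiv.commutes, AlgHom.commutes,
        ← aeval_algHom_apply] at h1
      simpa [ε, aeval_def, eval₂_eq_eval_map] using h1
    have h1 := key hμ
    have h2 := key ((neg_sq μ).trans hμ)
    have h3 : r.eval 0 ^ 2 = 0 := by linear_combination (h1 + h2 - 2 * hμ) / 2
    exact pow_eq_zero_iff two_ne_zero |>.1 h3
  obtain ⟨g, rfl⟩ : X ∣ r := X_dvd_iff.2 (by rwa [coeff_zero_eq_eval_zero])
  obtain ⟨D, hDG, hD⟩ := hG (C (1 / 2) * g)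
  obtain ⟨v, hv⟩ := IsAlgClosed.exists_pow_nat_eq (-a) two_pos
  obtain ⟨σ, hσG, hσh, hσf⟩ := exists_hyperbolic_mem hτ hτG hG (v := v) (by
    rintro rfl
    exact ha (by simpa using hv))
  rw [hv, neg_neg] at hσf
  have h : φ = D * σ := by
    refine PAut.ext_of_ph_of_pf ?_ ?_
    · change _ = D.val (σ.val _)
      have h2 : (2 : PQ k lam) * algebraMap k _ (1 / 2) = 1 := by
        rw [← map_ofNat (algebraMap k (PQ k lam)) 2, ← map_mul]
        norm_num
      rw [hσh, hD.2.1, hr, map_mul, map_mul, aeval_X, aeval_C]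
      linear_combination (-(pf k lam * aeval (pf k lam) g)) * h2
    · change _ = D.val (σ.val _)
      rw [hσf, map_mul, AlgEquiv.commutes, hD.2.2, hφ]
  exact h ▸ mul_mem hDG hσG

end Triangular

/-- Automorphisms lie in the subgroup generated by `τ` and the `Δ_g`, by induction on the degree
of the image of `f`. -/
theorem mem_of_degLE {K : Type*} [Field K] [IsAlgClosed K] [CharZero K] {lam : K}
    {B : PoissonBr K lam} {G : Subgroup (PAut B)} {τ : PAut B} (hτ : IsTau B τ) (hτG : τ ∈ G)
    (hG : ∀ g, ∃ D ∈ G, IsDelta B g D) (d : ℕ) : ∀ φ : PAut B,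
      DegLE (d - 1) (toLaurentPQ 1 1 (φ.val (pf K lam))) → φ ∈ G := by
  induction d with
  | zero =>
    intro φ hφ
    exfalso
    set x := toLaurentPQ 1 1 (φ.val (pf K lam)) with hx
    have hx0 : x ≠ 0 := by
      rw [hx, (map_ne_zero_iff _ (toLaurentPQ_injective one_ne_zero 1)),
        (map_ne_zero_iff _ φ.val.injective)]
      exact pf_ne_zero
    have hs : x.coeff.support.Nonempty := by
      rw [Finsupp.support_nonempty_iff]
      exact fun h => hx0 (LaurentPolynomial.ext fun n => by rw [h]; rfl)
    obtain ⟨α, hα, hmax⟩ := x.coeff.support.exists_max_image id hs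
    have hxα : DegLE α x := fun n hn => by
      by_contra h
      exact (hmax n (Finsupp.mem_support_iff.2 h)).not_gt hn
    have h1 := natDegree_coeff_le one_pos le_rfl hxα (Finsupp.mem_support_iff.1 hα)
    have h2 : 0 ≤ α := by omega
    exact Finsupp.mem_support_iff.1 hα (hφ α (by push_cast; omega))
  | succ d ih =>
    intro φ hφ
    push_cast at hφ
    rw [add_sub_cancel_right] at hφ
    by_cases h0 : (toLaurentPQ 1 1 (φ.val (pf K lam))).coeff d = 0
    · refine ih φ fun n hn => ?_
      rcases (show (d : ℤ) ≤ n by omega).eq_or_lt with rfl | hn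
      exacts [h0, hφ n hn]
    obtain ⟨σ, hσG, hσ, c, hc, hcoef⟩ := exists_mul_top_coeff_eq_C hτ hτG hG φ hφ h0
    refine (G.mul_mem_cancel_left hσG).1 ?_
    rcases exists_mul_degLE_pred hG (σ * φ) hσ hc hcoef with ⟨q, hq⟩ | ⟨σ', hσG', hσ'⟩
    · exact mem_of_map_pf_eq_aeval hτ hτG hG hq
    · exact (G.mul_mem_cancel_left hσG').1 (ih _ hσ')

/-- The group `Aut(P_λ)` is generated by `τ` together with the
automorphisms `Δ_g`, `g ∈ K[x]`. -/
theorem aut_Plam_generated_by_tau_and_deltas (B : PoissonBr K lam)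
    (τ : ↥(PAut B)) (hτ : IsTau B τ)
    (Δ : Polynomial K → ↥(PAut B)) (hΔ : ∀ g, IsDelta B g (Δ g)) :
    Subgroup.closure ({τ} ∪ Set.range Δ) = (⊤ : Subgroup ↥(PAut B)) := by
  rw [eq_top_iff]
  intro φ _
  set x := toLaurentPQ 1 1 (φ.val (pf K lam))
  refine mem_of_degLE hτ (Subgroup.subset_closure (.inl rfl))
    (fun g => ⟨Δ g, Subgroup.subset_closure (.inr ⟨g, rfl⟩), hΔ g⟩)
    (x.coeff.support.sup Int.toNat + 1) φ fun n hn => ?_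
  by_contra h
  have h1 : n.toNat ≤ x.coeff.support.sup Int.toNat :=
    Finset.le_sup (Finsupp.mem_support_iff.2 h)
  push_cast at hn
  omega
end
end

section
/- The subgroup A of linear automorphisms of P_λ is generated by τ together with the automorphisms Δ_α for all constant polynomials α ∈ K (i.e., Δ_α(e) = e − αh − α²f, Δ_α(h) = h + 2αf, Δ_α(f) = f). -/
noncomputable section

open scoped Pointwise

variable (K : Type*) [Field K] [IsAlgClosed K] [CharZero K] (lam : K)

variable {K lam}

/-- The subgroup `A ⊆ Aut(P_λ)` of linear automorphisms: automorphisms preserving the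
`K`-linear span of `{e, h, f}`. -/
def Asub (B : PoissonBr K lam) : Subgroup ↥(PAut B) where
  carrier := {D | D.val ''
      ((Submodule.span K {pe K lam, ph K lam, pf K lam} : Submodule K (PQ K lam)) : Set (PQ K lam)) =
      ((Submodule.span K {pe K lam, ph K lam, pf K lam} : Submodule K (PQ K lam)) : Set (PQ K lam))}
  one_mem' := by
    show (1 : (PQ K lam) ≃ₐ[K] (PQ K lam)) '' _ = _
    rw [show ⇑(1 : (PQ K lam) ≃ₐ[K] (PQ K lam)) = id from rfl, Set.image_id]
  mul_mem' := by
    intro a b ha hb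
    show (a.val * b.val) '' _ = _
    rw [show ⇑(a.val * b.val) = ⇑a.val ∘ ⇑b.val from rfl, Set.image_comp]
    rw [Set.mem_setOf_eq] at ha hb
    rw [hb, ha]
  inv_mem' := by
    intro a ha
    rw [Set.mem_setOf_eq] at ha ⊢
    conv_lhs => rw [← ha]
    show a.val.symm '' (a.val '' _) = _
    rw [← Set.image_comp]
    rw [show ⇑a.val.symm ∘ ⇑a.val = id from funext fun x => a.val.symm_apply_apply x, Set.image_id]

/-- The element `xe + yh + zf` of `P_λ`. -/
def linComb (lam x y z : K) : PQ K lam := x • pe K lam + y • ph K lam + z • pf K lam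

/-- The `K`-linear span of `e`, `h`, `f`. -/
def spanEHF (K : Type*) [Field K] [IsAlgClosed K] [CharZero K] (lam : K) :
    Submodule K (PQ K lam) :=
  Submodule.span K {pe K lam, ph K lam, pf K lam}

lemma mem_spanEHF {w : PQ K lam} : w ∈ spanEHF K lam ↔ ∃ x y z, linComb lam x y z = w :=
  Submodule.mem_span_triple

lemma linComb_mem_spanEHF (x y z : K) : linComb lam x y z ∈ spanEHF K lam :=
  mem_spanEHF.2 ⟨x, y, z, rfl⟩

lemma pe_eq_linComb : pe K lam = linComb lam 1 0 0 := by simp [linComb]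

lemma ph_eq_linComb : ph K lam = linComb lam 0 1 0 := by simp [linComb]

lemma pf_eq_linComb : pf K lam = linComb lam 0 0 1 := by simp [linComb]

/-- A point `(x, y, z)` with `4xz + y² = λ` annihilates the coefficients of a vanishing
linear combination of `e`, `h`, `f`. -/
lemma eval_eq_zero_of_linComb_eq_zero {a b c x y z : K} (hpt : 4 * x * z + y ^ 2 = lam)
    (H : linComb lam a b c = 0) : a * x + b * y + c * z = 0 := by
  have H' : (Ideal.Quotient.mk (Ideal.span {4 * MvPolynomial.X 0 * MvPolynomial.X 2 +
      MvPolynomial.X 1 ^ 2 - MvPolynomial.C lam}))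
      (a • MvPolynomial.X 0 + b • MvPolynomial.X 1 + c • MvPolynomial.X 2 :
        MvPolynomial (Fin 3) K) = 0 := H
  rw [Ideal.Quotient.eq_zero_iff_mem, Ideal.mem_span_singleton] at H'
  obtain ⟨q, hq⟩ := H'
  have := congrArg (MvPolynomial.eval ![x, y, z]) hq
  simp only [map_add, map_mul, map_sub, map_pow, MvPolynomial.smul_eval, MvPolynomial.eval_X,
    MvPolynomial.eval_C, map_ofNat] at this
  simpa [hpt] using this

/-- `e`, `h`, `f` are linearly independent. -/
lemma linComb_eq_zero {a b c : K} (H : linComb lam a b c = 0) : a = 0 ∧ b = 0 ∧ c = 0 := by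
  obtain ⟨y, hy⟩ := IsAlgClosed.exists_pow_nat_eq lam (n := 2) (by norm_num)
  have h₀ := eval_eq_zero_of_linComb_eq_zero (x := 0) (y := y) (z := 0) (by simpa using hy) H
  have h₁ := eval_eq_zero_of_linComb_eq_zero (x := 1) (y := y) (z := 0) (by simpa using hy) H
  have h₂ := eval_eq_zero_of_linComb_eq_zero (x := 0) (y := y) (z := 1) (by simpa using hy) H
  have h₃ := eval_eq_zero_of_linComb_eq_zero (x := (lam - 1) / 4) (y := 1) (z := 1)
    (by field_simp; ring) H
  have ha : a = 0 := by linear_combination h₁ - h₀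
  have hc : c = 0 := by linear_combination h₂ - h₀
  subst ha hc
  exact ⟨rfl, by simpa using h₃, rfl⟩

lemma linComb_inj {a b c x y z : K} (H : linComb lam a b c = linComb lam x y z) :
    a = x ∧ b = y ∧ c = z := by
  have := linComb_eq_zero (lam := lam) (a := a - x) (b := b - y) (c := c - z) (by
    rw [← sub_eq_zero] at H
    rw [← H]
    simp only [linComb]
    module)
  simpa only [sub_eq_zero] using this

lemma map_linComb {B : PoissonBr K lam} (D : ↥(PAut B)) (x y z : K) :
    D.val (linComb lam x y z) =
      x • D.val (pe K lam) + y • D.val (ph K lam) + z • D.val (pf K lam) := by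
  simp only [linComb, map_add, map_smul]

lemma PoissonBr.skew (B : PoissonBr K lam) (a b : PQ K lam) : B.br a b = -B.br b a := by
  have H := B.alternate (a + b)
  rw [B.add_left, B.add_right, B.add_right, B.alternate, B.alternate, zero_add, add_zero] at H
  exact eq_neg_of_add_eq_zero_left H

lemma PoissonBr.br_linComb (B : PoissonBr K lam) (a b c x y z : K) :
    B.br (linComb lam a b c) (linComb lam x y z) =
      linComb lam (2 * (b * x - a * y)) (a * z - c * x) (2 * (c * y - b * z)) := by
  have hhe : B.br (ph K lam) (pe K lam) = (2 : K) • pe K lam := by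
    rw [B.br_he, two_mul, two_smul]
  have hhf : B.br (ph K lam) (pf K lam) = (-2 : K) • pf K lam := by
    rw [B.br_hf, neg_smul, two_smul]
    ring
  simp only [linComb, B.add_left, B.add_right, B.smul_left, B.smul_right, B.alternate]
  rw [B.skew (pe K lam) (ph K lam), B.skew (pf K lam) (ph K lam), B.skew (pf K lam) (pe K lam),
    hhe, hhf, B.br_ef]
  module

lemma PAut.ext_generators {B : PoissonBr K lam} {D E : ↥(PAut B)}
    (he : D.val (pe K lam) = E.val (pe K lam)) (hh : D.val (ph K lam) = E.val (ph K lam))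
    (hf : D.val (pf K lam) = E.val (pf K lam)) : D = E := by
  have H : (D.val : PQ K lam →ₐ[K] PQ K lam) = E.val := by
    apply Ideal.Quotient.algHom_ext
    apply MvPolynomial.algHom_ext
    intro i
    fin_cases i
    exacts [he, hh, hf]
  exact Subtype.ext (AlgEquiv.ext fun x => DFunLike.congr_fun H x)

lemma mem_Asub_iff {B : PoissonBr K lam} {D : ↥(PAut B)} :
    D ∈ Asub B ↔ (spanEHF K lam).map D.val.toLinearMap = spanEHF K lam := by
  rw [← SetLike.coe_set_eq, Submodule.map_coe]
  rfl

lemma mem_Asub_of_generators {B : PoissonBr K lam} {D : ↥(PAut B)}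
    (he : D.val (pe K lam) ∈ spanEHF K lam) (hh : D.val (ph K lam) ∈ spanEHF K lam)
    (hf : D.val (pf K lam) ∈ spanEHF K lam)
    (he' : ∃ w ∈ spanEHF K lam, D.val w = pe K lam)
    (hh' : ∃ w ∈ spanEHF K lam, D.val w = ph K lam)
    (hf' : ∃ w ∈ spanEHF K lam, D.val w = pf K lam) : D ∈ Asub B := by
  rw [mem_Asub_iff]
  apply le_antisymm
  · rw [Submodule.map_le_iff_le_comap]
    refine Submodule.span_le.2 ?_
    rintro _ (rfl | rfl | rfl)
    exacts [he, hh, hf]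
  · refine Submodule.span_le.2 ?_
    rintro _ (rfl | rfl | rfl)
    exacts [he', hh', hf']

lemma map_mem_spanEHF {B : PoissonBr K lam} {D : ↥(PAut B)} (hD : D ∈ Asub B) {w : PQ K lam}
    (hw : w ∈ spanEHF K lam) : D.val w ∈ spanEHF K lam := by
  rw [mem_Asub_iff] at hD
  rw [← hD]
  exact Submodule.mem_map_of_mem hw

lemma IsTau.map_linComb {B : PoissonBr K lam} {D : ↥(PAut B)} (hD : IsTau B D) (x y z : K) :
    D.val (linComb lam x y z) = linComb lam z (-y) x := by
  rw [_root_.map_linComb, hD.1, hD.2.1, hD.2.2]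
  simp only [linComb]
  module

lemma IsDelta.map_linComb {B : PoissonBr K lam} {D : ↥(PAut B)} {α : K}
    (hD : IsDelta B (Polynomial.C α) D) (x y z : K) :
    D.val (linComb lam x y z) =
      linComb lam x (y - α * x) (z + 2 * α * y - α ^ 2 * x) := by
  rw [_root_.map_linComb, hD.1, hD.2.1, hD.2.2]
  have hh : Polynomial.aeval (pf K lam) (Polynomial.C α) * ph K lam = α • ph K lam := by
    rw [Polynomial.aeval_C]
    exact (Algebra.smul_def α _).symm
  have hf : pf K lam * Polynomial.aeval (pf K lam) (Polynomial.C α) = α • pf K lam := by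
    rw [Polynomial.aeval_C, mul_comm]
    exact (Algebra.smul_def α _).symm
  have hf₂ : pf K lam * Polynomial.aeval (pf K lam) (Polynomial.C α) ^ 2 = α ^ 2 • pf K lam := by
    rw [Polynomial.aeval_C, ← map_pow, mul_comm]
    exact (Algebra.smul_def (α ^ 2) _).symm
  have h2 : (2 : PQ K lam) * (α • pf K lam) = (2 * α) • pf K lam := by
    rw [two_mul]
    module
  rw [hh, hf, hf₂, h2]
  simp only [linComb]
  module

lemma IsTau.mem_Asub {B : PoissonBr K lam} {D : ↥(PAut B)} (hD : IsTau B D) : D ∈ Asub B := by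
  apply mem_Asub_of_generators
  iterate 3
    · simp only [pe_eq_linComb, ph_eq_linComb, pf_eq_linComb, hD.map_linComb]
      exact linComb_mem_spanEHF _ _ _
  · exact ⟨_, linComb_mem_spanEHF 0 0 1, by rw [hD.map_linComb, pe_eq_linComb]; simp⟩
  · exact ⟨_, linComb_mem_spanEHF 0 (-1) 0, by rw [hD.map_linComb, ph_eq_linComb]; simp⟩
  · exact ⟨_, linComb_mem_spanEHF 1 0 0, by rw [hD.map_linComb, pf_eq_linComb]; simp⟩

lemma IsDelta.mem_Asub {B : PoissonBr K lam} {D : ↥(PAut B)} {α : K}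
    (hD : IsDelta B (Polynomial.C α) D) : D ∈ Asub B := by
  apply mem_Asub_of_generators
  iterate 3
    · simp only [pe_eq_linComb, ph_eq_linComb, pf_eq_linComb, hD.map_linComb]
      exact linComb_mem_spanEHF _ _ _
  · refine ⟨_, linComb_mem_spanEHF 1 α (-α ^ 2), ?_⟩
    rw [hD.map_linComb, pe_eq_linComb]
    congr 1 <;> ring
  · refine ⟨_, linComb_mem_spanEHF 0 1 (-2 * α), ?_⟩
    rw [hD.map_linComb, ph_eq_linComb]
    congr 1 <;> ring
  · refine ⟨_, linComb_mem_spanEHF 0 0 1, ?_⟩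
    rw [hD.map_linComb, pf_eq_linComb]
    congr 1 <;> ring

/-- If `D` preserves the span of `e`, `h`, `f`, then `D(f)` is a nilpotent element of `sl₂`. -/
lemma exists_map_pf_eq {B : PoissonBr K lam} {D : ↥(PAut B)} (hD : D ∈ Asub B) :
    ∃ x y z : K, D.val (pf K lam) = linComb lam x y z ∧ y ^ 2 + x * z = 0 := by
  obtain ⟨a, b, c, he⟩ := mem_spanEHF.1 (map_mem_spanEHF hD
    (pe_eq_linComb (lam := lam) ▸ linComb_mem_spanEHF 1 0 0))
  obtain ⟨p, q, r, hh⟩ := mem_spanEHF.1 (map_mem_spanEHF hD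
    (ph_eq_linComb (lam := lam) ▸ linComb_mem_spanEHF 0 1 0))
  obtain ⟨x, y, z, hf⟩ := mem_spanEHF.1 (map_mem_spanEHF hD
    (pf_eq_linComb (lam := lam) ▸ linComb_mem_spanEHF 0 0 1))
  refine ⟨x, y, z, hf.symm, ?_⟩
  have hef := D.2 (pe K lam) (pf K lam)
  have hhf := D.2 (ph K lam) (pf K lam)
  rw [B.br_ef, ← he, ← hf, ← hh, B.br_linComb] at hef
  rw [ph_eq_linComb, pf_eq_linComb, B.br_linComb, ← ph_eq_linComb, ← pf_eq_linComb,
    map_linComb, ← hf, ← hh, B.br_linComb] at hhf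
  obtain ⟨hp, hq, hr⟩ := linComb_inj hef
  obtain ⟨hx, hy, hz⟩ := linComb_inj (a := -2 * x) (b := -2 * y) (c := -2 * z)
    (Eq.trans (by simp only [linComb]; module) hhf)
  by_contra hN
  have hp0 : p = 0 := (mul_eq_zero_iff_left hN).1 (by subst hp hq hr; grind)
  have hq0 : q = 0 := (mul_eq_zero_iff_left hN).1 (by subst hp hq hr; grind)
  have hr0 : r = 0 := (mul_eq_zero_iff_left hN).1 (by subst hp hq hr; grind)
  grind

/-- A linear automorphism fixing `f` is of the form `Δ_α`. -/
lemma eq_delta_of_map_pf_eq {B : PoissonBr K lam} {D : ↥(PAut B)} (hD : D ∈ Asub B)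
    (hf : D.val (pf K lam) = pf K lam) {Δ : Polynomial K → ↥(PAut B)}
    (hΔ : ∀ g, IsDelta B g (Δ g)) : ∃ α : K, Δ (Polynomial.C α) = D := by
  obtain ⟨a, b, c, he⟩ := mem_spanEHF.1 (map_mem_spanEHF hD
    (pe_eq_linComb (lam := lam) ▸ linComb_mem_spanEHF 1 0 0))
  obtain ⟨p, q, r, hh⟩ := mem_spanEHF.1 (map_mem_spanEHF hD
    (ph_eq_linComb (lam := lam) ▸ linComb_mem_spanEHF 0 1 0))
  have hef := D.2 (pe K lam) (pf K lam)
  have hhf := D.2 (ph K lam) (pf K lam)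
  have hhe := D.2 (ph K lam) (pe K lam)
  rw [B.br_ef, ← he, hf, ← hh, pf_eq_linComb, B.br_linComb] at hef
  rw [ph_eq_linComb, pf_eq_linComb, B.br_linComb, ← ph_eq_linComb, ← pf_eq_linComb,
    map_linComb, hf, ← hh, pf_eq_linComb, B.br_linComb] at hhf
  rw [ph_eq_linComb, pe_eq_linComb, B.br_linComb, ← ph_eq_linComb, ← pe_eq_linComb,
    map_linComb, ← he, ← hh, B.br_linComb] at hhe
  obtain ⟨hp, hq, hr⟩ := linComb_inj hef
  obtain ⟨-, -, hz⟩ := linComb_inj (a := 0) (b := 0) (c := -2)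
    (Eq.trans (by simp only [linComb]; module) hhf)
  obtain ⟨-, -, hc⟩ := linComb_inj (a := 2 * a) (b := 2 * b) (c := 2 * c)
    (Eq.trans (by simp only [linComb]; module) hhe)
  refine ⟨r / 2, PAut.ext_generators ?_ ?_ ?_⟩
  · rw [← he, pe_eq_linComb, (hΔ _).map_linComb]
    congr 1 <;> grind
  · rw [← hh, ph_eq_linComb, (hΔ _).map_linComb]
    congr 1 <;> grind
  · rw [hf, (hΔ _).2.2]

/-- A subgroup containing `τ` and all `Δ_α` acts transitively on the nonzero nilpotent elements
of the span of `e`, `h`, `f`. -/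
lemma exists_mem_map_linComb_eq_pf {B : PoissonBr K lam} {τ : ↥(PAut B)} (hτ : IsTau B τ)
    {Δ : Polynomial K → ↥(PAut B)} (hΔ : ∀ g, IsDelta B g (Δ g)) {G : Subgroup ↥(PAut B)}
    (hτG : τ ∈ G) (hΔG : ∀ α : K, Δ (Polynomial.C α) ∈ G) {x y z : K}
    (hN : y ^ 2 + x * z = 0) (hne : linComb lam x y z ≠ 0) :
    ∃ g ∈ G, g.val (linComb lam x y z) = pf K lam := by
  have key : ∀ z : K, z ≠ 0 → ∃ g ∈ G, g.val (linComb lam 0 0 z) = pf K lam := by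
    intro z hz
    obtain ⟨α, hα⟩ := IsAlgClosed.exists_pow_nat_eq (-z) (n := 2) (by norm_num)
    have hα0 : α ≠ 0 := by
      rintro rfl
      exact hz (by simpa using hα.symm)
    refine ⟨τ * (Δ (Polynomial.C α) * (τ * (Δ (Polynomial.C (-α⁻¹)) *
      (τ * Δ (Polynomial.C α))))), ?_, ?_⟩
    · exact mul_mem hτG (mul_mem (hΔG _) (mul_mem hτG (mul_mem (hΔG _)
        (mul_mem hτG (hΔG _)))))
    · simp only [Subgroup.coe_mul, AlgEquiv.mul_apply, hτ.map_linComb, (hΔ _).map_linComb]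
      rw [pf_eq_linComb]
      congr 1 <;> grind
  by_cases hx : x = 0
  · subst hx
    obtain rfl : y = 0 := by simpa using hN
    refine key z ?_
    rintro rfl
    exact hne (by simp [linComb])
  · obtain ⟨g, hg, hgf⟩ := key x hx
    refine ⟨g * (τ * Δ (Polynomial.C (y / x))), mul_mem hg (mul_mem hτG (hΔG _)), ?_⟩
    rw [← hgf]
    simp only [Subgroup.coe_mul, AlgEquiv.mul_apply, hτ.map_linComb, (hΔ _).map_linComb]
    congr 2 <;> field_simp <;> grind

/-- The subgroup `A` of linear automorphisms of `P_λ` is generated by `τ`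
together with the automorphisms `Δ_α` for constant polynomials `α ∈ K`. -/
theorem linear_subgroup_generated_by_tau_and_const_deltas (B : PoissonBr K lam)
    (τ : ↥(PAut B)) (hτ : IsTau B τ)
    (Δ : Polynomial K → ↥(PAut B)) (hΔ : ∀ g, IsDelta B g (Δ g)) :
    Subgroup.closure ({τ} ∪ Set.range (fun α : K => Δ (Polynomial.C α))) = Asub B := by
  set G := Subgroup.closure ({τ} ∪ Set.range (fun α : K => Δ (Polynomial.C α))) with hG
  have hGA : G ≤ Asub B := by
    rw [hG, Subgroup.closure_le]
    rintro _ (rfl | ⟨α, rfl⟩)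
    exacts [hτ.mem_Asub, (hΔ _).mem_Asub]
  refine le_antisymm hGA fun D hD => ?_
  have hτG : τ ∈ G := Subgroup.subset_closure (Or.inl rfl)
  have hΔG : ∀ α : K, Δ (Polynomial.C α) ∈ G :=
    fun α => Subgroup.subset_closure (Or.inr ⟨α, rfl⟩)
  obtain ⟨x, y, z, hf, hN⟩ := exists_map_pf_eq hD
  have hne : linComb lam x y z ≠ 0 := by
    rw [← hf, Ne, EmbeddingLike.map_eq_zero_iff, pf_eq_linComb]
    exact fun H => one_ne_zero (linComb_eq_zero H).2.2
  obtain ⟨g, hg, hgf⟩ := exists_mem_map_linComb_eq_pf hτ hΔ hτG hΔG hN hne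
  obtain ⟨α, hα⟩ := eq_delta_of_map_pf_eq (mul_mem (hGA hg) hD)
    (by rw [Subgroup.coe_mul, AlgEquiv.mul_apply, hf, hgf]) hΔ
  rw [← G.mul_mem_cancel_left hg, ← hα]
  exact hΔG α
end
end

section
/- For every g ∈ K[x], the adjoint map ad(g(f)) : P_λ → P_λ, a ↦ {g(f), a}, is a locally nilpotent derivation of P_λ: it is a K-linear derivation for the commutative product, and for every a ∈ P_λ there exists N ≥ 0 such that ad(g(f))^N(a) = 0. -/
noncomputable section

open scoped Pointwise

variable (K : Type*) [Field K] [IsAlgClosed K] [CharZero K] (lam : K)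

variable {K lam}

/-- The elements annihilated by some power of a derivation form a subalgebra. -/
def Derivation.locallyNilpotentSubalgebra {R A : Type*} [CommSemiring R] [CommSemiring A]
    [Algebra R A] (D : Derivation R A A) : Subalgebra R A where
  carrier := {a | ∃ n : ℕ, D^[n] a = 0}
  algebraMap_mem' r := ⟨1, D.map_algebraMap r⟩
  add_mem' := by
    rintro a b ⟨n, hn⟩ ⟨m, hm⟩
    refine ⟨n + m, ?_⟩
    rw [iterate_map_add, Function.iterate_add_apply D n m b, hm, add_comm n m,
      Function.iterate_add_apply D m n a, hn, iterate_map_zero, iterate_map_zero, add_zero]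
  mul_mem' := by
    have key : ∀ k n m : ℕ, n + m = k → ∀ a b : A, D^[n] a = 0 → D^[m] b = 0 →
        D^[k] (a * b) = 0 := by
      intro k
      induction k with
      | zero =>
        intro n m hk a b hn _
        obtain ⟨rfl, rfl⟩ : n = 0 ∧ m = 0 := by omega
        have : a = 0 := hn
        simp [this]
      | succ k ih =>
        intro n m hk a b hn hm
        rcases n with _ | n
        · have : a = 0 := hn
          rw [this, zero_mul, iterate_map_zero]
        rcases m with _ | m
        · have : b = 0 := hm
          rw [this, mul_zero, iterate_map_zero]
        rw [Function.iterate_succ_apply, D.leibniz, iterate_map_add, smul_eq_mul, smul_eq_mul,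
          ih (n + 1) m (by omega) a (D b) hn hm, ih (m + 1) n (by omega) b (D a) hm hn, add_zero]
    rintro a b ⟨n, hn⟩ ⟨m, hm⟩
    exact ⟨n + m, key _ n m rfl a b hn hm⟩

theorem Derivation.mem_locallyNilpotentSubalgebra_of_apply_mem {R A : Type*} [CommSemiring R]
    [CommSemiring A] [Algebra R A] (D : Derivation R A A) {a : A}
    (h : D a ∈ D.locallyNilpotentSubalgebra) : a ∈ D.locallyNilpotentSubalgebra := by
  obtain ⟨n, hn⟩ := h
  exact ⟨n + 1, hn⟩

theorem Subalgebra.aeval_mem {R A : Type*} [CommSemiring R] [CommSemiring A] [Algebra R A]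
    (S : Subalgebra R A) {a : A} (ha : a ∈ S) (p : Polynomial R) : Polynomial.aeval a p ∈ S :=
  Algebra.adjoin_le (Set.singleton_subset_iff.2 ha) (Polynomial.aeval_mem_adjoin_singleton R a)

/-- A subalgebra of `P_λ` containing `e`, `h` and `f` is everything. -/
theorem PQ.mem_of_generators_mem (S : Subalgebra K (PQ K lam)) (he : pe K lam ∈ S)
    (hh : ph K lam ∈ S) (hf : pf K lam ∈ S) (a : PQ K lam) : a ∈ S := by
  obtain ⟨p, rfl⟩ := Ideal.Quotient.mk_surjective a
  induction p using MvPolynomial.induction_on with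
  | C r => exact S.algebraMap_mem r
  | add p q hp hq => rw [map_add]; exact S.add_mem hp hq
  | mul_X p i hp =>
    rw [map_mul]
    refine S.mul_mem hp ?_
    fin_cases i
    exacts [he, hh, hf]

namespace PoissonBr

theorem br_swap (B : PoissonBr K lam) (a b : PQ K lam) : B.br a b = -B.br b a := by
  have h := B.alternate (a + b)
  rw [B.add_left, B.add_right, B.add_right, B.alternate, B.alternate, zero_add, add_zero] at h
  exact eq_neg_of_add_eq_zero_left h

/-- The adjoint map `b ↦ {a, b}`, as a derivation of the commutative product. -/
def ad (B : PoissonBr K lam) (a : PQ K lam) : Derivation K (PQ K lam) (PQ K lam) :=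
  Derivation.mk'
    { toFun := B.br a
      map_add' := B.add_right a
      map_smul' := fun μ b => B.smul_right μ a b }
    fun b c => by
      change B.br a (b * c) = b * B.br a c + c * B.br a b
      rw [B.leibniz, mul_comm c]

theorem ad_apply (B : PoissonBr K lam) (a b : PQ K lam) : B.ad a b = B.br a b := rfl

theorem ad_aeval_apply (B : PoissonBr K lam) (a b : PQ K lam) (g : Polynomial K) :
    B.ad (Polynomial.aeval a g) b = -(Polynomial.aeval a g.derivative * B.br b a) := by
  rw [ad_apply, br_swap, ← ad_apply, Derivation.map_aeval, smul_eq_mul, ad_apply]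

theorem locallyNilpotent_ad_aeval_pf (B : PoissonBr K lam) (g : Polynomial K) (a : PQ K lam) :
    a ∈ (B.ad (Polynomial.aeval (pf K lam) g)).locallyNilpotentSubalgebra := by
  set D := B.ad (Polynomial.aeval (pf K lam) g) with hD
  set S := D.locallyNilpotentSubalgebra
  have hf : pf K lam ∈ S := D.mem_locallyNilpotentSubalgebra_of_apply_mem <| by
    rw [hD, ad_aeval_apply, B.alternate, mul_zero, neg_zero]
    exact S.zero_mem
  have hg : Polynomial.aeval (pf K lam) g.derivative ∈ S := S.aeval_mem hf _
  have hh : ph K lam ∈ S := D.mem_locallyNilpotentSubalgebra_of_apply_mem <| by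
    rw [hD, ad_aeval_apply, B.br_hf]
    exact S.neg_mem (S.mul_mem hg (S.mul_mem (S.neg_mem (ofNat_mem S 2)) hf))
  have he : pe K lam ∈ S := D.mem_locallyNilpotentSubalgebra_of_apply_mem <| by
    rw [hD, ad_aeval_apply, B.br_ef]
    exact S.neg_mem (S.mul_mem hg hh)
  exact PQ.mem_of_generators_mem S he hh hf a

end PoissonBr

/-- For every `g ∈ K[x]`, the adjoint map `ad(g(f)) : a ↦ {g(f), a}` is a
locally nilpotent `K`-linear derivation of `P_λ`. -/
theorem ad_g_f_locally_nilpotent_derivation (B : PoissonBr K lam) (g : Polynomial K) :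
    (∀ a b : PQ K lam,
        B.br (Polynomial.aeval (pf K lam) g) (a + b) =
          B.br (Polynomial.aeval (pf K lam) g) a + B.br (Polynomial.aeval (pf K lam) g) b) ∧
    (∀ (μ : K) (a : PQ K lam),
        B.br (Polynomial.aeval (pf K lam) g) (μ • a) =
          μ • B.br (Polynomial.aeval (pf K lam) g) a) ∧
    (∀ a b : PQ K lam,
        B.br (Polynomial.aeval (pf K lam) g) (a * b) =
          a * B.br (Polynomial.aeval (pf K lam) g) b +
            B.br (Polynomial.aeval (pf K lam) g) a * b) ∧
    (∀ a : PQ K lam, ∃ N : ℕ,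
        (fun x => B.br (Polynomial.aeval (pf K lam) g) x)^[N] a = 0) :=
  ⟨B.add_right _, fun μ => B.smul_right μ _, B.leibniz _, B.locallyNilpotent_ad_aeval_pf g⟩
end
end

section
/- Every element of T can be written uniquely in the form e ↦ αe − αg(f)h − αf·g(f)², h ↦ h + 2f·g(f), f ↦ α⁻¹f, for some g ∈ K[x] and α ∈ Kˣ. -/
noncomputable section

open scoped Pointwise

variable (K : Type*) [Field K] [IsAlgClosed K] [CharZero K] (lam : K)

variable {K lam}

/-- `t` has the triangular normal form with parameters `g` and `α`. -/
def IsTriangular (g : Polynomial K) (α : Kˣ) (t : (PQ K lam) ≃ₐ[K] (PQ K lam)) : Prop :=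
  t (pe K lam) =
      (α : K) • pe K lam -
        (α : K) • (Polynomial.aeval (pf K lam) g * ph K lam) -
        (α : K) • (pf K lam * Polynomial.aeval (pf K lam) g ^ 2) ∧
  t (ph K lam) = ph K lam + 2 * (pf K lam * Polynomial.aeval (pf K lam) g) ∧
  t (pf K lam) = ((α : K))⁻¹ • pf K lam

namespace IsTriangular

set_option linter.unusedSectionVars false

theorem one : IsTriangular 0 1 (1 : (PQ K lam) ≃ₐ[K] (PQ K lam)) := by
  simp [IsTriangular]

theorem mul {g k : Polynomial K} {α β : Kˣ} {t s : (PQ K lam) ≃ₐ[K] (PQ K lam)}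
    (ht : IsTriangular g α t) (hs : IsTriangular k β s) :
    IsTriangular
      (g + Polynomial.C (α : K)⁻¹ * k.comp (Polynomial.C (α : K)⁻¹ * Polynomial.X))
      (α * β) (t * s) := by
  obtain ⟨hte, hth, htf⟩ := ht
  obtain ⟨hse, hsh, hsf⟩ := hs
  have hk : t (Polynomial.aeval (pf K lam) k) =
      Polynomial.aeval ((α : K)⁻¹ • pf K lam) k := by
    rw [← htf, Polynomial.aeval_algHom_apply]
  have hα : algebraMap K (PQ K lam) (α : K) * algebraMap K (PQ K lam) (α : K)⁻¹ = 1 := by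
    rw [← map_mul, mul_inv_cancel₀ α.ne_zero, map_one]
  simp only [IsTriangular, AlgEquiv.mul_apply, hse, hsh, hsf, map_sub, map_add, map_mul, map_pow,
    map_smul, map_ofNat, hk, hte, hth, htf, Polynomial.aeval_comp, Polynomial.aeval_C,
    Polynomial.aeval_X, Units.val_mul, mul_inv]
  simp only [Algebra.smul_def (A := PQ K lam), map_mul]
  generalize Polynomial.aeval (algebraMap K (PQ K lam) (α : K)⁻¹ * pf K lam) k = k'
  generalize Polynomial.aeval (pf K lam) g = g'
  generalize algebraMap K (PQ K lam) (α : K)⁻¹ = a' at *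
  generalize algebraMap K (PQ K lam) (α : K) = a at *
  refine ⟨?_, by ring, by ring⟩
  grind

theorem inv {g : Polynomial K} {α : Kˣ} {t : (PQ K lam) ≃ₐ[K] (PQ K lam)}
    (ht : IsTriangular g α t) :
    IsTriangular
      (-(Polynomial.C (α : K) * g.comp (Polynomial.C (α : K) * Polynomial.X))) α⁻¹ t⁻¹ := by
  obtain ⟨hte, hth, htf⟩ := ht
  have hα : algebraMap K (PQ K lam) (α : K) * algebraMap K (PQ K lam) (α : K)⁻¹ = 1 := by
    rw [← map_mul, mul_inv_cancel₀ α.ne_zero, map_one]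
  have hg : t (Polynomial.aeval (algebraMap K (PQ K lam) (α : K) * pf K lam) g) =
      Polynomial.aeval (pf K lam) g := by
    rw [← Polynomial.aeval_algHom_apply, map_mul, AlgEquiv.commutes, htf,
      Algebra.smul_def (A := PQ K lam), ← mul_assoc, hα, one_mul]
  simp only [IsTriangular, AlgEquiv.aut_inv, AlgEquiv.symm_apply_eq, map_sub, map_add, map_mul,
    map_pow, map_neg, map_smul, map_ofNat, hte, hth, htf, Polynomial.aeval_comp,
    Polynomial.aeval_C, Polynomial.aeval_X, hg, AlgEquiv.commutes, Units.val_inv_eq_inv_val,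
    inv_inv]
  simp only [Algebra.smul_def (A := PQ K lam)]
  generalize Polynomial.aeval (pf K lam) g = g'
  generalize algebraMap K (PQ K lam) (α : K)⁻¹ = a' at *
  generalize algebraMap K (PQ K lam) (α : K) = a at *
  refine ⟨?_, ?_, ?_⟩ <;> grind

/-- The parameters of a normal form are unique: map `P_λ` to `K[x]` by `e ↦ 0`, `h ↦ √λ`,
`f ↦ x`. -/
theorem unique {g k : Polynomial K} {α β : Kˣ} {t : (PQ K lam) ≃ₐ[K] (PQ K lam)}
    (h : IsTriangular g α t) (h' : IsTriangular k β t) : g = k ∧ α = β := by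
  obtain ⟨r, hr⟩ := IsAlgClosed.exists_pow_nat_eq lam (n := 2) (by norm_num)
  let ψ : MvPolynomial (Fin 3) K →ₐ[K] Polynomial K :=
    MvPolynomial.aeval ![0, Polynomial.C r, Polynomial.X]
  let φ : PQ K lam →ₐ[K] Polynomial K := Ideal.Quotient.liftₐ _ ψ (by
    intro a ha
    rw [← RingHom.mem_ker]
    refine (Ideal.span_singleton_le_iff_mem _).mpr ?_ ha
    simp [ψ, RingHom.mem_ker, ← hr])
  have hφ : φ (pf K lam) = Polynomial.X :=
    (MvPolynomial.aeval_X _ 2).trans rfl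
  have h2 : φ 2 ≠ 0 := (map_ofNat φ 2).trans_ne two_ne_zero
  obtain ⟨-, hh, hf⟩ := h
  obtain ⟨-, hh', hf'⟩ := h'
  constructor
  · have key := congrArg φ (hh.symm.trans hh')
    simpa [← Polynomial.aeval_algHom_apply, hφ, h2] using key
  · have key := congrArg (fun x ↦ (φ x).coeff 1) (hf.symm.trans hf')
    exact Units.ext (by simpa [hφ] using key)

end IsTriangular

/-- Every element of `T = ⟨J, H⟩` can be written uniquely in the form
`e ↦ αe − αg(f)h − αf·g(f)²`, `h ↦ h + 2f·g(f)`, `f ↦ α⁻¹f` with `g ∈ K[x]`, `α ∈ Kˣ`. -/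
theorem triangular_normal_form (B : PoissonBr K lam)
    (Δ : Polynomial K → ↥(PAut B)) (hΔ : ∀ g, IsDelta B g (Δ g))
    (HR : Kˣ → ↥(PAut B)) (hHR : ∀ β, IsHRot B β (HR β)) :
    ∀ t ∈ Subgroup.closure (Set.range Δ ∪ Set.range HR),
      ∃! p : Polynomial K × Kˣ,
        t.val (pe K lam) =
            (p.2 : K) • pe K lam -
              (p.2 : K) • (Polynomial.aeval (pf K lam) p.1 * ph K lam) -
              (p.2 : K) • (pf K lam * Polynomial.aeval (pf K lam) p.1 ^ 2) ∧
        t.val (ph K lam) =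
            ph K lam + 2 * (pf K lam * Polynomial.aeval (pf K lam) p.1) ∧
        t.val (pf K lam) = ((p.2 : K))⁻¹ • pf K lam := by
  intro t ht
  obtain ⟨g, α, hg⟩ : ∃ g α, IsTriangular g α t.val := by
    induction ht using Subgroup.closure_induction with
    | mem x hx =>
      rcases hx with ⟨g, rfl⟩ | ⟨β, rfl⟩
      · exact ⟨g, 1, by simpa [IsTriangular, IsDelta] using hΔ g⟩
      · exact ⟨0, β, by simpa [IsTriangular, IsHRot] using hHR β⟩
    | one => exact ⟨0, 1, .one⟩
    | mul x y _ _ hx hy =>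
      obtain ⟨g, α, hx⟩ := hx
      obtain ⟨k, β, hy⟩ := hy
      exact ⟨_, _, hx.mul hy⟩
    | inv x _ hx =>
      obtain ⟨g, α, hx⟩ := hx
      exact ⟨_, _, hx.inv⟩
  refine ⟨(g, α), hg, fun p hp ↦ ?_⟩
  obtain ⟨h₁, h₂⟩ := IsTriangular.unique hp hg
  exact Prod.ext h₁ h₂
end
end
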